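/- Assume Condition 1, and assume that the limit distribution p satisfies p_0 < 1 and p_1 < 1. For κ ≥ 1, let T_κ be a plane rooted tree with m_κ := |T_κ| → ∞ as κ → ∞. If |n_κ| · π_{p(n_κ)}(T_κ) → ∞ as κ → ∞, then (N_{T_κ}(𝒯_{n_κ}) − |n_κ| π_{p(n_κ)}(T_κ)) / (|n_κ| π_{p(n_κ)}(T_κ))^{1/2} converges in distribution to the standard normal distribution N(0,1), with convergence of mean and variance; in particular E[N_{T_κ}(𝒯_{n_κ})] ∼ Var[N_{T_κ}(𝒯_{n_κ})] ∼ |n_κ| π_{p(n_κ)}(T_κ) as κ → ∞. -/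

import Mathlib

/-!
Common definitions: plane rooted trees, fringe subtree counts, random trees with
a given degree statistic, Poisson/normal limit notions, conditioned Galton–Watson
trees, and sampling without replacement.
-/

open Filter MeasureTheory
open scoped Topology Classical

/-- A plane rooted tree: a root together with a linearly ordered (possibly empty)
list of subtrees. Structural equality coincides with isomorphism of plane rooted trees. -/
inductive PlaneTree : Type
  | node : List PlaneTree → PlaneTree

namespace PlaneTree

/-- The (out)degree of the root: its number of children. -/
def degree : PlaneTree → ℕ
  | node ts => ts.length

mutual
  /-- The list of all fringe subtrees of a tree (one for each vertex). -/
  def fringe : PlaneTree → List PlaneTree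
    | node ts => node ts :: fringeList ts
  def fringeList : List PlaneTree → List PlaneTree
    | [] => []
    | t :: ts => fringe t ++ fringeList ts
end

/-- The number of vertices `|T|` of a plane tree. -/
def size (T : PlaneTree) : ℕ := T.fringe.length

/-- The degree statistic `n_T` of a tree: `n_T(i)` is the number of vertices with `i` children. -/
noncomputable def degStat (T : PlaneTree) : ℕ →₀ ℕ :=
  Multiset.toFinsupp ((T.fringe.map degree : List ℕ) : Multiset ℕ)

/-- `N_{T'}(T)`: the number of fringe subtrees of `T` equal to `T'`. -/
noncomputable def countTree (T' T : PlaneTree) : ℕ :=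
  (T.fringe.filter fun t => decide (t = T')).length

/-- `N_m(T)` for a degree statistic `m`: the number of fringe subtrees of `T`
with degree statistic `m`. -/
noncomputable def countStat (m : ℕ →₀ ℕ) (T : PlaneTree) : ℕ :=
  (T.fringe.filter fun t => decide (degStat t = m)).length

/-- `N_m(T)` for an integer `m`: the number of fringe subtrees of `T` of size `m`. -/
noncomputable def countSize (m : ℕ) (T : PlaneTree) : ℕ :=
  (T.fringe.filter fun t => decide (size t = m)).length

end PlaneTree

/-- `n : ℕ →₀ ℕ` is a degree statistic: `∑ n(i) = 1 + ∑ i·n(i)`. -/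
def IsDegStat (n : ℕ →₀ ℕ) : Prop :=
  (n.sum fun _ c => c) = 1 + n.sum fun i c => i * c

/-- `|n| = ∑_i n(i)`, the size of a degree statistic. -/
def nsize (n : ℕ →₀ ℕ) : ℕ := n.sum fun _ c => c

/-- The set `𝕋_n` of plane trees with degree statistic `n`. -/
def treesWith (n : ℕ →₀ ℕ) : Set PlaneTree := {T | PlaneTree.degStat T = n}

/-- `|𝕋_n|`, the number of plane trees with degree statistic `n`. -/
noncomputable def numTrees (n : ℕ →₀ ℕ) : ℕ := (treesWith n).ncard

/-- The probability that a uniformly random tree `𝒯_n ∈ 𝕋_n` satisfies `P`. -/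
noncomputable def prob (n : ℕ →₀ ℕ) (P : PlaneTree → Prop) : ℝ :=
  (({T ∈ treesWith n | P T}).ncard : ℝ) / (numTrees n : ℝ)

/-- The expectation `E[f(𝒯_n)]` of an `ℕ`-valued functional of the uniformly
random tree `𝒯_n ∈ 𝕋_n`. -/
noncomputable def expect (n : ℕ →₀ ℕ) (f : PlaneTree → ℕ) : ℝ :=
  ∑' k : ℕ, (k : ℝ) * prob n (fun T => f T = k)

/-- The variance `Var[f(𝒯_n)]`. -/
noncomputable def variance (n : ℕ →₀ ℕ) (f : PlaneTree → ℕ) : ℝ :=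
  expect n (fun T => (f T) ^ 2) - (expect n f) ^ 2

/-- The empirical degree distribution `p_i(n) = n(i)/|n|`. -/
noncomputable def empDist (n : ℕ →₀ ℕ) (i : ℕ) : ℝ := (n i : ℝ) / (nsize n : ℝ)

/-- `π_p(T) = ∏_{i ≥ 0} p_i^{n_T(i)}`. -/
noncomputable def piDist (p : ℕ → ℝ) (T : PlaneTree) : ℝ :=
  (PlaneTree.degStat T).prod fun i c => p i ^ c

/-- `π_p(𝕋_m) = |𝕋_m| · ∏_{i ≥ 0} p_i^{m(i)}`. -/
noncomputable def piSet (p : ℕ → ℝ) (m : ℕ →₀ ℕ) : ℝ :=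
  (numTrees m : ℝ) * m.prod fun i c => p i ^ c

/-- Condition 1: the `nseq κ` are degree statistics with `|n_κ| → ∞` and
`p_i(n_κ) → p_i` for every `i`, where `p` is a probability distribution on `ℕ`. -/
def Condition1 (nseq : ℕ → (ℕ →₀ ℕ)) (p : ℕ → ℝ) : Prop :=
  (∀ κ, IsDegStat (nseq κ)) ∧
  Tendsto (fun κ => nsize (nseq κ)) atTop atTop ∧
  (∀ i, 0 ≤ p i) ∧ HasSum p 1 ∧
  (∀ i, Tendsto (fun κ => empDist (nseq κ) i) atTop (𝓝 (p i)))

/-- Condition 2: in addition, `∑ i² p_i(n_κ) → ∑ i² p_i < ∞`. -/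
def Condition2 (nseq : ℕ → (ℕ →₀ ℕ)) (p : ℕ → ℝ) : Prop :=
  Summable (fun i : ℕ => (i : ℝ) ^ 2 * p i) ∧
  Tendsto (fun κ => ∑' i : ℕ, (i : ℝ) ^ 2 * empDist (nseq κ) i) atTop
    (𝓝 (∑' i : ℕ, (i : ℝ) ^ 2 * p i))

/-- `σ_p² = ∑_{i ≥ 0} (i-1)² p_i`. -/
noncomputable def sigmaSq (p : ℕ → ℝ) : ℝ := ∑' i : ℕ, ((i : ℝ) - 1) ^ 2 * p i

/-- The point probabilities of the Poisson distribution `Po(lam)`. -/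
noncomputable def poissonPMF (lam : ℝ) (k : ℕ) : ℝ :=
  Real.exp (-lam) * lam ^ k / (Nat.factorial k : ℝ)

/-- The `q`-th moment of the Poisson distribution `Po(lam)`. -/
noncomputable def poissonMoment (lam : ℝ) (q : ℕ) : ℝ :=
  ∑' k : ℕ, (k : ℝ) ^ q * poissonPMF lam k

/-- The standard normal cumulative distribution function. -/
noncomputable def stdNormalCDF (x : ℝ) : ℝ :=
  ∫ t in Set.Iic x, Real.exp (-t ^ 2 / 2) / Real.sqrt (2 * Real.pi)

/-- The total variation distance between the law of `f(𝒯_n)` and `Po(lam)`: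
`sup_A |P(f(𝒯_n) ∈ A) − Po(lam)(A)|`. -/
noncomputable def dTVPoisson (n : ℕ →₀ ℕ) (f : PlaneTree → ℕ) (lam : ℝ) : ℝ :=
  ⨆ A : Set ℕ, |prob n (fun T => f T ∈ A) - ∑' k : ℕ, A.indicator (poissonPMF lam) k|

/-- A probability distribution on `ℕ` is nonlattice: the gcd of the differences of
points of its support is `1`. -/
def Nonlattice (p : ℕ → ℝ) : Prop :=
  ∀ h : ℕ, (∀ i j : ℕ, 0 < p i → 0 < p j → (h : ℤ) ∣ (i : ℤ) - (j : ℤ)) → h = 1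

/-- The partition function `P(|𝒯_p| = n)` of a Galton–Watson tree with offspring
distribution `p`. -/
noncomputable def gwZ (p : ℕ → ℝ) (n : ℕ) : ℝ :=
  ∑' T : PlaneTree, if PlaneTree.size T = n then piDist p T else 0

/-- `P(𝒯_{p,n} ∈ {T | P T})` for the conditioned Galton–Watson tree `𝒯_{p,n}`. -/
noncomputable def probGW (p : ℕ → ℝ) (n : ℕ) (P : PlaneTree → Prop) : ℝ :=
  (∑' T : PlaneTree, if PlaneTree.size T = n ∧ P T then piDist p T else 0) / gwZ p n

/-- The expectation `E[f(𝒯_{p,n})]` for an `ℕ`-valued functional. -/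
noncomputable def expectGW (p : ℕ → ℝ) (n : ℕ) (f : PlaneTree → ℕ) : ℝ :=
  ∑' k : ℕ, (k : ℝ) * probGW p n (fun T => f T = k)

/-- The filter `n → ∞` along the sizes `n` for which the conditioning `|𝒯_p| = n`
is well defined. -/
noncomputable def gwFilter (p : ℕ → ℝ) : Filter ℕ :=
  atTop ⊓ Filter.principal {n | 0 < gwZ p n}

/-- A positive function on the positive reals is slowly varying at infinity. -/
def SlowlyVarying (L : ℝ → ℝ) : Prop :=
  (∀ x : ℝ, 0 < x → 0 < L x) ∧
  ∀ c : ℝ, 0 < c → Tendsto (fun x : ℝ => L (c * x) / L x) atTop (𝓝 1)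

/-- The probability that a uniformly random permutation of `Fin n` satisfies `P`. -/
noncomputable def probPerm {n : ℕ} (P : Equiv.Perm (Fin n) → Prop) : ℝ :=
  ((Finset.univ.filter P).card : ℝ) / ((Finset.univ : Finset (Equiv.Perm (Fin n))).card : ℝ)

/-- `S_m = ∑_{i=1}^m d_{τ(i)}`: the sum of `m` of the values `d`, drawn without
replacement via the permutation `τ`. -/
def sampleSum {n : ℕ} (d : Fin n → ℤ) (m : ℕ) (τ : Equiv.Perm (Fin n)) : ℤ :=
  ∑ i : Fin n, if (i : ℕ) < m then d (τ i) else 0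

/-- The mean `d̄` of the values `d`. -/
noncomputable def dbar {n : ℕ} (d : Fin n → ℤ) : ℝ := (∑ i : Fin n, (d i : ℝ)) / n

/-- `Q = ∑_i (d_i − d̄)²`. -/
noncomputable def Qval {n : ℕ} (d : Fin n → ℤ) : ℝ := ∑ i : Fin n, ((d i : ℝ) - dbar d) ^ 2

/-- `σ̂² = (m/n)(1 − m/n) Q`. -/
noncomputable def sigHatSq {n : ℕ} (d : Fin n → ℤ) (m : ℕ) : ℝ :=
  ((m : ℝ) / n) * (1 - (m : ℝ) / n) * Qval d

/-- The empirical frequency `p_k(d) = #{i : d_i = k}/n`. -/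
noncomputable def empFreq {n : ℕ} (d : Fin n → ℤ) (k : ℤ) : ℝ :=
  ((Finset.univ.filter (fun i => d i = k)).card : ℝ) / n

/-- The characteristic function `φ_{S_m}(t) = E[exp(i t S_m)]` of the sample sum. -/
noncomputable def charFn {n : ℕ} (d : Fin n → ℤ) (m : ℕ) (t : ℝ) : ℂ :=
  (Fintype.card (Equiv.Perm (Fin n)) : ℂ)⁻¹ *
    ∑ τ : Equiv.Perm (Fin n), Complex.exp (Complex.I * t * (sampleSum d m τ : ℂ))

/-- A probability distribution on `ℤ` is nonlattice. -/
def NonlatticeZ (p : ℤ → ℝ) : Prop :=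
  ∀ h : ℕ, (∀ i j : ℤ, 0 < p i → 0 < p j → (h : ℤ) ∣ i - j) → h = 1

theorem eq_gaussianReal_of_lintegral_exp (ν : Measure ℝ) [IsProbabilityMeasure ν]
    (h : ∀ c : ℝ, 0 < c →
      ∫⁻ y, ENNReal.ofReal (Real.exp (c * y)) ∂ν = ENNReal.ofReal (Real.exp (c ^ 2 / 2))) :
    ν = ProbabilityTheory.gaussianReal 0 1 := by
  have hint : ∀ c : ℝ, 0 < c → Integrable (fun y : ℝ => Real.exp (c * y)) ν := by
    intro c hc
    refine ⟨by fun_prop, ?_⟩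
    rw [hasFiniteIntegral_iff_ofReal (Eventually.of_forall fun y => (Real.exp_pos _).le), h c hc]
    exact ENNReal.ofReal_lt_top
  have hmgf : ∀ c : ℝ, 0 < c → ProbabilityTheory.mgf id ν c = Real.exp (c ^ 2 / 2) := by
    intro c hc
    rw [ProbabilityTheory.mgf]
    simp only [id]
    rw [integral_eq_lintegral_of_nonneg_ae (Eventually.of_forall fun y => (Real.exp_pos _).le)
      (by fun_prop), h c hc, ENNReal.toReal_ofReal (Real.exp_pos _).le]
  have hsub : Set.Ioi (0 : ℝ) ⊆ interior (ProbabilityTheory.integrableExpSet id ν) := by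
    rw [isOpen_Ioi.subset_interior_iff]
    intro c hc
    exact hint c hc
  have hEq : Set.EqOn (ProbabilityTheory.complexMGF id ν) (fun z => Complex.exp (z ^ 2 / 2))
      {z : ℂ | 0 < z.re} := by
    have hX : AnalyticOnNhd ℂ (ProbabilityTheory.complexMGF id ν) {z : ℂ | 0 < z.re} :=
      ProbabilityTheory.analyticOnNhd_complexMGF.mono fun z hz => hsub hz
    have hY : AnalyticOnNhd ℂ (fun z => Complex.exp (z ^ 2 / 2)) {z : ℂ | 0 < z.re} := by
      refine DifferentiableOn.analyticOnNhd (by fun_prop) ?_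
      exact isOpen_lt continuous_const Complex.continuous_re
    refine AnalyticOnNhd.eqOn_of_preconnected_of_frequently_eq hX hY
      (convex_halfSpace_re_gt 0).isPreconnected (z₀ := (1 : ℂ)) (by simp) ?_
    have ht : Tendsto (fun n : ℕ => ((1 + 1 / ((n : ℝ) + 1) : ℝ) : ℂ)) atTop (𝓝[≠] (1 : ℂ)) := by
      rw [tendsto_nhdsWithin_iff]
      constructor
      · have : Tendsto (fun n : ℕ => (1 + 1 / ((n : ℝ) + 1) : ℝ)) atTop (𝓝 (1 + 0)) :=
          tendsto_const_nhds.add tendsto_one_div_add_atTop_nhds_zero_nat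
        have h2 := (Complex.continuous_ofReal.tendsto _).comp this
        simpa [Function.comp_def] using h2
      · refine Eventually.of_forall fun n => ?_
        simp only [Set.mem_compl_iff, Set.mem_singleton_iff]
        intro hh
        have h3 : (1 + 1 / ((n : ℝ) + 1) : ℝ) = 1 := by exact_mod_cast hh
        have : 0 < 1 / ((n : ℝ) + 1) := by positivity
        linarith
    refine ht.frequently (Frequently.of_forall fun n => ?_)
    have hpos : 0 < (1 + 1 / ((n : ℝ) + 1) : ℝ) := by positivity
    rw [ProbabilityTheory.complexMGF_ofReal, hmgf _ hpos]
    push_cast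
    rfl
  refine Measure.ext_of_charFun ?_
  ext t
  rw [ProbabilityTheory.charFun_gaussianReal]
  have hz : Tendsto (fun n : ℕ => (1 / ((n : ℝ) + 1) : ℝ)) atTop (𝓝 0) :=
    tendsto_one_div_add_atTop_nhds_zero_nat
  have hre : ∀ a y : ℝ, (((a : ℂ) + t * Complex.I) * y).re = a * y := fun a y => by simp
  have hlim1 : Tendsto (fun n : ℕ =>
      ∫ y, Complex.exp (((1 / ((n : ℝ) + 1) : ℝ) + t * Complex.I) * y) ∂ν) atTop
      (𝓝 (charFun ν t)) := by
    rw [charFun_apply_real]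
    refine tendsto_integral_of_dominated_convergence (fun y => 1 + Real.exp (1 * y))
      (fun n => by fun_prop) ((integrable_const 1).add (hint 1 one_pos)) ?_ ?_
    · intro n
      refine Eventually.of_forall fun y => ?_
      rw [Complex.norm_exp]
      have h1 : (((1 / ((n : ℝ) + 1) : ℝ) + t * Complex.I) * y : ℂ).re
          = 1 / ((n : ℝ) + 1) * y := hre _ y
      rw [h1]
      rcases le_total 0 y with hy | hy
      · have : 1 / ((n : ℝ) + 1) * y ≤ 1 * y := by
          refine mul_le_mul_of_nonneg_right ?_ hy
          rw [div_le_one (by positivity)]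
          linarith [Nat.cast_nonneg (α := ℝ) n]
        linarith [Real.exp_le_exp.mpr this]
      · have : 1 / ((n : ℝ) + 1) * y ≤ 0 := mul_nonpos_of_nonneg_of_nonpos (by positivity) hy
        have h2 := Real.exp_le_exp.mpr this
        rw [Real.exp_zero] at h2
        linarith [Real.exp_pos (1 * y)]
    · refine Eventually.of_forall fun y => ?_
      have h4 : Tendsto (fun n : ℕ => ((((1 / ((n : ℝ) + 1) : ℝ) : ℂ) + t * Complex.I) * y : ℂ))
          atTop (𝓝 ((((0 : ℝ) : ℂ) + t * Complex.I) * y)) :=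
        (((Complex.continuous_ofReal.tendsto _).comp hz).add_const _).mul_const _
      have h5 := (Complex.continuous_exp.tendsto _).comp h4
      have h6 : (t * y * Complex.I : ℂ) = (((0 : ℝ) : ℂ) + t * Complex.I) * y := by
        rw [Complex.ofReal_zero]
        ring
      rw [h6]
      exact h5
  have hlim2 : Tendsto (fun n : ℕ =>
      ∫ y, Complex.exp (((1 / ((n : ℝ) + 1) : ℝ) + t * Complex.I) * y) ∂ν) atTop
      (𝓝 (Complex.exp ((((0 : ℝ) : ℂ) + t * Complex.I) ^ 2 / 2))) := by
    have h4 : Tendsto (fun n : ℕ => Complex.exp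
        ((((1 / ((n : ℝ) + 1) : ℝ) : ℂ) + t * Complex.I) ^ 2 / 2))
        atTop (𝓝 (Complex.exp ((((0 : ℝ) : ℂ) + t * Complex.I) ^ 2 / 2))) :=
      (Complex.continuous_exp.tendsto _).comp
        (((((Complex.continuous_ofReal.tendsto _).comp hz).add_const _).pow 2).div_const 2)
    refine h4.congr fun n => ?_
    have hpos : 0 < (1 / ((n : ℝ) + 1) : ℝ) := by positivity
    have hmem : 0 < (((1 / ((n : ℝ) + 1) : ℝ) : ℂ) + t * Complex.I).re := by
      have := hre (1 / ((n : ℝ) + 1)) 1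
      rw [Complex.ofReal_one, mul_one, mul_one] at this
      rw [this]
      exact hpos
    exact (hEq hmem).symm
  rw [tendsto_nhds_unique hlim1 hlim2]
  congr 1
  simp only [Complex.ofReal_zero, zero_add, mul_pow, Complex.I_sq]
  simp
  ring

theorem abs_log_one_add_sub_le {u : ℝ} (hu : |u| ≤ 1 / 2) :
    |Real.log (1 + u) - u| ≤ 2 * u ^ 2 := by
  obtain ⟨h1, h2⟩ := abs_le.mp hu
  have hpos : 0 < 1 + u := by linarith
  have hup := Real.log_le_sub_one_of_pos hpos
  have hlo := Real.one_sub_inv_le_log_of_pos hpos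
  have : u - 2 * u ^ 2 ≤ 1 - (1 + u)⁻¹ := by
    rw [← sub_nonneg]
    have : 1 - (1 + u)⁻¹ - (u - 2 * u ^ 2) = u ^ 2 * (1 + 2 * u) / (1 + u) := by
      field_simp
      ring
    rw [this]
    exact div_nonneg (mul_nonneg (sq_nonneg u) (by linarith)) hpos.le
  rw [abs_le]
  constructor <;> nlinarith [sq_nonneg u]

theorem cast_descFactorial_eq_prod {x k : ℕ} (h : k ≤ x) :
    (x.descFactorial k : ℝ) = ∏ j ∈ Finset.range k, ((x : ℝ) - j) := by
  rw [Nat.descFactorial_eq_prod_range]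
  push_cast
  refine Finset.prod_congr rfl fun j hj => ?_
  rw [Nat.cast_sub (by have := Finset.mem_range.mp hj; omega)]

theorem tendstoUniformly_descFactorial_div_pow {ι : Type*} {l : Filter ι} {lam : ι → ℝ}
    {k : ι → ℕ} {c : ℝ} (hlam : Tendsto lam l atTop)
    (hk : Tendsto (fun i => (k i : ℝ) / √(lam i)) l (𝓝 c)) (hc : 0 ≤ c) {M ε : ℝ} (hM : 0 < M)
    (hε : 0 < ε) :
    ∀ᶠ i in l, ∀ x : ℕ, |((x : ℝ) - lam i) / √(lam i)| ≤ M →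
      |(x.descFactorial (k i) : ℝ) / lam i ^ k i
        - Real.exp (c * (((x : ℝ) - lam i) / √(lam i)) - c ^ 2 / 2)| ≤ ε := by
  have hsq : Tendsto (fun i => (√(lam i))⁻¹) l (𝓝 0) :=
    (Real.tendsto_sqrt_atTop.comp hlam).inv_tendsto_atTop
  set q : ι → ℝ := fun i => (k i : ℝ) / √(lam i) with hq
  set s : ι → ℝ := fun i => (M + q i) * (√(lam i))⁻¹ with hs
  have hs0 : Tendsto s l (𝓝 0) := by
    simpa using (tendsto_const_nhds (x := M) |>.add hk).mul hsq
  set r : ι → ℝ := fun i => |q i - c| * M + |q i ^ 2 / 2 - q i * (√(lam i))⁻¹ / 2 - c ^ 2 / 2|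
    + 2 * (q i * (M + q i) * s i) with hr
  have hr0 : Tendsto r l (𝓝 0) := by
    have h1 : Tendsto (fun i => |q i - c| * M) l (𝓝 0) := by
      simpa using ((hk.sub_const c).abs).mul_const M
    have h2 : Tendsto (fun i => |q i ^ 2 / 2 - q i * (√(lam i))⁻¹ / 2 - c ^ 2 / 2|) l (𝓝 0) := by
      have := ((((hk.pow 2).div_const 2).sub ((hk.mul hsq).div_const 2)).sub_const
        (c ^ 2 / 2)).abs
      rwa [mul_zero, zero_div, sub_zero, sub_self, abs_zero] at this
    have h3 : Tendsto (fun i => 2 * (q i * (M + q i) * s i)) l (𝓝 0) := by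
      simpa using ((hk.mul (hk.const_add M)).mul hs0).const_mul 2
    simpa using (h1.add h2).add h3
  have hE : Tendsto (fun i => Real.exp (c * M) * (Real.exp (r i) - 1)) l (𝓝 0) := by
    have := ((Real.continuous_exp.tendsto 0).comp hr0)
    simpa using (this.sub_const 1).const_mul (Real.exp (c * M))
  filter_upwards [hlam.eventually_gt_atTop 0, hs0.eventually_le_const (show (0 : ℝ) < 1 / 2 by norm_num),
    hE.eventually_le_const hε] with i hpos hsi hEi x hx
  have hsqrt : 0 < √(lam i) := Real.sqrt_pos.mpr hpos
  have hmul : √(lam i) * √(lam i) = lam i := Real.mul_self_sqrt hpos.le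
  set y := ((x : ℝ) - lam i) / √(lam i) with hy
  have hxe : (x : ℝ) = lam i + y * √(lam i) := by rw [hy]; field_simp; ring
  have hke : (k i : ℝ) = q i * √(lam i) := by simp only [hq]; field_simp
  have hq0 : 0 ≤ q i := by simp only [hq]; positivity
  set u : ℕ → ℝ := fun j => y * (√(lam i))⁻¹ - j / lam i with hu
  have hu_le : ∀ j ∈ Finset.range (k i), |u j| ≤ s i := by
    intro j hj
    have hj' : (j : ℝ) ≤ k i := by exact_mod_cast (Finset.mem_range.mp hj).le
    have h1 : |y * (√(lam i))⁻¹| ≤ M * (√(lam i))⁻¹ := by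
      rw [abs_mul, abs_of_pos (inv_pos.mpr hsqrt)]
      gcongr
    have h2 : |(j : ℝ) / lam i| ≤ q i * (√(lam i))⁻¹ := by
      rw [abs_of_nonneg (by positivity)]
      calc (j : ℝ) / lam i ≤ k i / lam i := by gcongr
        _ = q i * (√(lam i))⁻¹ := by rw [hke, mul_div_assoc, Real.sqrt_div_self]
    calc |u j| ≤ |y * (√(lam i))⁻¹| + |(j : ℝ) / lam i| := abs_sub _ _
      _ ≤ s i := by simp only [hs]; linarith
  have hu_pos : ∀ j ∈ Finset.range (k i), 0 < 1 + u j := by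
    intro j hj
    have := (abs_le.mp (hu_le j hj)).1
    linarith
  have hterm : ∀ j : ℕ, ((x : ℝ) - j) / lam i = 1 + u j := by
    intro j
    simp only [hu]
    rw [hxe, sub_div, add_div, div_self hpos.ne', mul_div_assoc, Real.sqrt_div_self, add_sub_assoc]
  have hkx : k i ≤ x := by
    by_contra hlt
    push Not at hlt
    have h1 := hu_pos x (Finset.mem_range.mpr hlt)
    rw [← hterm x] at h1
    simp at h1
  have hprod : (x.descFactorial (k i) : ℝ) / lam i ^ k i
      = Real.exp (∑ j ∈ Finset.range (k i), Real.log (1 + u j)) := by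
    rw [cast_descFactorial_eq_prod hkx, Real.exp_sum]
    conv_lhs => rw [← Finset.card_range (k i), ← Finset.prod_const, Finset.card_range,
      ← Finset.prod_div_distrib]
    refine Finset.prod_congr rfl fun j hj => ?_
    rw [Real.exp_log (hu_pos j hj), hterm]
  have hsum : ∑ j ∈ Finset.range (k i), u j = q i * y - (q i ^ 2 / 2 - q i * (√(lam i))⁻¹ / 2) := by
    have hg : ∑ j ∈ Finset.range (k i), (j : ℝ) = (k i : ℝ) * (k i - 1) / 2 := by
      induction k i with
      | zero => simp
      | succ n ih => rw [Finset.sum_range_succ, ih]; push_cast; ring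
    simp only [hu]
    rw [Finset.sum_sub_distrib, ← Finset.sum_div, hg, Finset.sum_const, Finset.card_range,
      nsmul_eq_mul, hke]
    nth_rewrite 5 [← hmul]
    field_simp
  have hlogsum : |∑ j ∈ Finset.range (k i), Real.log (1 + u j) - ∑ j ∈ Finset.range (k i), u j|
      ≤ 2 * (q i * (M + q i) * s i) := by
    rw [← Finset.sum_sub_distrib]
    calc _ ≤ ∑ j ∈ Finset.range (k i), |Real.log (1 + u j) - u j| := Finset.abs_sum_le_sum_abs _ _
      _ ≤ ∑ j ∈ Finset.range (k i), 2 * s i ^ 2 := by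
        refine Finset.sum_le_sum fun j hj => ?_
        refine (abs_log_one_add_sub_le ((hu_le j hj).trans hsi)).trans ?_
        have : u j ^ 2 ≤ s i ^ 2 := sq_le_sq' (by linarith [(abs_le.mp (hu_le j hj)).1])
          (abs_le.mp (hu_le j hj)).2
        linarith
      _ = 2 * (q i * (M + q i) * s i) := by
        rw [Finset.sum_const, Finset.card_range, nsmul_eq_mul, hke]
        simp only [hs]
        field_simp
  set A := ∑ j ∈ Finset.range (k i), Real.log (1 + u j) with hA
  set B := c * y - c ^ 2 / 2 with hB
  have hAB : |A - B| ≤ r i := by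
    have e : A - B = (A - ∑ j ∈ Finset.range (k i), u j) + (q i - c) * y
        - (q i ^ 2 / 2 - q i * (√(lam i))⁻¹ / 2 - c ^ 2 / 2) := by
      rw [hsum, hB]; ring
    rw [e]
    have h1 := abs_sub ((A - ∑ j ∈ Finset.range (k i), u j) + (q i - c) * y)
      (q i ^ 2 / 2 - q i * (√(lam i))⁻¹ / 2 - c ^ 2 / 2)
    have h2 := abs_add_le (A - ∑ j ∈ Finset.range (k i), u j) ((q i - c) * y)
    have h3 : |(q i - c) * y| ≤ |q i - c| * M := by
      rw [abs_mul]; gcongr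
    simp only [hr]
    linarith
  rw [hprod]
  have hBle : B ≤ c * M := by
    have := mul_le_mul_of_nonneg_left (abs_le.mp hx).2 hc
    have := sq_nonneg c
    simp only [hB]; linarith
  have hfac : Real.exp A - Real.exp B = Real.exp B * (Real.exp (A - B) - 1) := by
    rw [mul_sub, ← Real.exp_add]; ring_nf
  have habs : |Real.exp (A - B) - 1| ≤ Real.exp (r i) - 1 := by
    have h1 : Real.exp (A - B) ≤ Real.exp (r i) := Real.exp_le_exp.mpr (abs_le.mp hAB).2
    have h2 : Real.exp (-(r i)) ≤ Real.exp (A - B) := Real.exp_le_exp.mpr (abs_le.mp hAB).1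
    have h3 : 2 ≤ Real.exp (r i) + Real.exp (-(r i)) := by
      have := Real.one_le_cosh (r i)
      rw [Real.cosh_eq] at this
      linarith
    rw [abs_le]; constructor <;> linarith
  rw [hfac, abs_mul, abs_of_pos (Real.exp_pos B)]
  refine le_trans ?_ hEi
  have := Real.exp_le_exp.mpr hBle
  have h0 : 0 ≤ Real.exp (r i) - 1 := (abs_nonneg _).trans habs
  gcongr

theorem sq_descFactorial_div_pow_le {x k : ℕ} {lam C : ℝ} (hlam : 0 < lam)
    (hk4 : 4 * (k : ℝ) ≤ lam) (hkC : (k : ℝ) ^ 2 ≤ C * lam) :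
    ((x.descFactorial k : ℝ) / lam ^ k) ^ 2
      ≤ 1 + Real.exp (2 * C) * ((x.descFactorial (2 * k) : ℝ) / lam ^ (2 * k)) := by
  rcases lt_or_ge (x : ℝ) lam with hx | hx
  · have h1 : (x.descFactorial k : ℝ) ≤ lam ^ k := by
      calc (x.descFactorial k : ℝ) ≤ (x : ℝ) ^ k := by exact_mod_cast Nat.descFactorial_le_pow x k
        _ ≤ lam ^ k := by gcongr
    have h2 : (x.descFactorial k : ℝ) / lam ^ k ≤ 1 := by
      rw [div_le_one (by positivity)]; exact h1
    have h3 : ((x.descFactorial k : ℝ) / lam ^ k) ^ 2 ≤ 1 := pow_le_one₀ (by positivity) h2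
    have : 0 ≤ Real.exp (2 * C) * ((x.descFactorial (2 * k) : ℝ) / lam ^ (2 * k)) := by positivity
    linarith
  · have hkx : 4 * k ≤ x := by exact_mod_cast hk4.trans hx
    have hA : (x.descFactorial k : ℝ) ≤ Real.exp (2 * C) * ((x - k).descFactorial k : ℝ) := by
      rw [cast_descFactorial_eq_prod (by omega), cast_descFactorial_eq_prod (by omega),
        Nat.cast_sub (by omega)]
      have h1 : ∀ j ∈ Finset.range k, (x : ℝ) - j ≤ Real.exp (2 * k / lam) * ((x : ℝ) - k - j) := by
        intro j hj
        have hj' : (j : ℝ) ≤ k := by exact_mod_cast (Finset.mem_range.mp hj).le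
        have h2 := Real.add_one_le_exp (2 * k / lam)
        have h3 : lam / 2 ≤ (x : ℝ) - k - j := by linarith
        have h4 : (2 * k / lam + 1) * ((x : ℝ) - k - j)
            ≤ Real.exp (2 * k / lam) * ((x : ℝ) - k - j) :=
          mul_le_mul_of_nonneg_right h2 (by linarith)
        have h5 : (k : ℝ) ≤ 2 * k / lam * ((x : ℝ) - k - j) := by
          calc (k : ℝ) = 2 * k / lam * (lam / 2) := by field_simp
            _ ≤ _ := by gcongr
        linarith
      have h6 : ∀ j ∈ Finset.range k, (0 : ℝ) ≤ (x : ℝ) - j := by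
        intro j hj
        have hj' : (j : ℝ) ≤ k := by exact_mod_cast (Finset.mem_range.mp hj).le
        linarith
      refine (Finset.prod_le_prod h6 h1).trans ?_
      rw [Finset.prod_mul_distrib, Finset.prod_const, Finset.card_range, ← Real.exp_nat_mul]
      refine mul_le_mul_of_nonneg_right ?_ ?_
      · rw [Real.exp_le_exp]
        calc (k : ℝ) * (2 * k / lam) = 2 * (k : ℝ) ^ 2 / lam := by ring
          _ ≤ 2 * (C * lam) / lam := by gcongr
          _ = 2 * C := by field_simp
      · refine Finset.prod_nonneg fun j hj => ?_
        have hj' : (j : ℝ) ≤ k := by exact_mod_cast (Finset.mem_range.mp hj).le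
        linarith
    have hB : (x.descFactorial (2 * k) : ℝ) = (x - k).descFactorial k * x.descFactorial k := by
      rw [two_mul]
      have := Nat.descFactorial_mul_descFactorial (n := x) (k := k) (m := k + k) (by omega)
      rw [Nat.add_sub_cancel] at this
      exact_mod_cast this.symm
    have : ((x.descFactorial k : ℝ) / lam ^ k) ^ 2
        ≤ Real.exp (2 * C) * ((x.descFactorial (2 * k) : ℝ) / lam ^ (2 * k)) := by
      rw [hB, div_pow, ← pow_mul, mul_comm k 2, ← mul_div_assoc]
      gcongr
      rw [sq, ← mul_assoc]
      gcongr
    linarith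

/-- The law of `Y` under the uniform distribution on the nonempty finite set `S`. -/
noncomputable def uniformLaw {α : Type*} (S : Finset α) (hS : S.Nonempty) (Y : α → ℝ) :
    ProbabilityMeasure ℝ :=
  ⟨(S.card : ENNReal)⁻¹ • ∑ a ∈ S, Measure.dirac (Y a), ⟨by
    have h : (S.card : ENNReal) ≠ 0 := by exact_mod_cast hS.card_pos.ne'
    simp [Measure.finsetSum_apply, ENNReal.inv_mul_cancel h (ENNReal.natCast_ne_top _)]⟩⟩

theorem integral_uniformLaw {α : Type*} (S : Finset α) (hS : S.Nonempty) (Y : α → ℝ)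
    (f : ℝ → ℝ) : ∫ y, f y ∂(uniformLaw S hS Y : Measure ℝ) = (∑ a ∈ S, f (Y a)) / S.card := by
  change ∫ y, f y ∂((S.card : ENNReal)⁻¹ • ∑ a ∈ S, Measure.dirac (Y a)) = _
  rw [integral_smul_measure, integral_finsetSum_measure]
  · simp [div_eq_inv_mul]
  · intro a _
    exact integrable_dirac (by simp)

theorem uniformLaw_real_apply {α : Type*} (S : Finset α) (hS : S.Nonempty) (Y : α → ℝ)
    {A : Set ℝ} (hA : MeasurableSet A) :
    (uniformLaw S hS Y : Measure ℝ).real A = ((S.filter fun a => Y a ∈ A).card : ℝ) / S.card := by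
  rw [← integral_indicator_one hA, integral_uniformLaw, Finset.card_filter]
  push_cast
  simp [Set.indicator_apply]

theorem uniformLaw_compl_closedBall_le {α : Type*} (S : Finset α) (hS : S.Nonempty) (Y : α → ℝ)
    {B M : ℝ} (hM : 0 < M) (hB : (∑ a ∈ S, Y a ^ 2) / S.card ≤ B) :
    (uniformLaw S hS Y : Measure ℝ).real (Metric.closedBall 0 M)ᶜ ≤ B / M ^ 2 := by
  rw [← integral_indicator_one Metric.isClosed_closedBall.measurableSet.compl, integral_uniformLaw,
    le_div_iff₀ (by positivity), div_mul_eq_mul_div, Finset.sum_mul]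
  refine le_trans ?_ hB
  gcongr with a ha
  by_cases h : Y a ∈ (Metric.closedBall 0 M)ᶜ
  · rw [Set.indicator_of_mem h]
    simp only [Set.mem_compl_iff, Metric.mem_closedBall, dist_zero_right, Real.norm_eq_abs,
      not_le] at h
    simp only [Pi.one_apply, one_mul]
    rw [← sq_abs (Y a)]
    gcongr
  · rw [Set.indicator_of_notMem h, zero_mul]
    positivity

/-- A continuous cutoff: `1` on `[-M, M]` and `0` outside `[-(M + 1), M + 1]`. -/
noncomputable def cutoff (M y : ℝ) : ℝ := max 0 (min 1 (M + 1 - |y|))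

theorem cutoff_nonneg (M y : ℝ) : 0 ≤ cutoff M y := le_max_left _ _

theorem cutoff_le_one (M y : ℝ) : cutoff M y ≤ 1 := by simp [cutoff]

theorem cutoff_eq_zero {M y : ℝ} (h : M + 1 ≤ |y|) : cutoff M y = 0 := by
  rw [cutoff, max_eq_left]
  exact (min_le_right _ _).trans (by linarith)

theorem cutoff_eq_one {M y : ℝ} (h : |y| ≤ M) : cutoff M y = 1 := by
  rw [cutoff, min_eq_left (by linarith), max_eq_right zero_le_one]

theorem cutoff_mono (y : ℝ) : Monotone fun M => cutoff M y := by
  intro M M' h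
  simp only [cutoff]
  gcongr

theorem one_sub_cutoff_le {M y : ℝ} (hM : 0 < M) : 1 - cutoff M y ≤ |y| / M := by
  rcases le_total (|y|) M with h | h
  · rw [cutoff_eq_one h, sub_self]
    positivity
  · have : 1 ≤ |y| / M := by rwa [one_le_div hM]
    linarith [cutoff_nonneg M y]

theorem lintegral_exp_of_tendsto_cutoff (ν : Measure ℝ) [IsProbabilityMeasure ν] {c K : ℝ}
    (h : ∀ M : ℕ, 0 < M →
      |∫ y, Real.exp (c * y - c ^ 2 / 2) * cutoff M y ∂ν - 1| ≤ K / M) :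
    ∫⁻ y, ENNReal.ofReal (Real.exp (c * y)) ∂ν = ENNReal.ofReal (Real.exp (c ^ 2 / 2)) := by
  set g : ℕ → ℝ → ℝ := fun M y => Real.exp (c * y - c ^ 2 / 2) * cutoff M y with hg
  have hgnn : ∀ M y, 0 ≤ g M y := fun M y => mul_nonneg (Real.exp_pos _).le (cutoff_nonneg _ _)
  have hgc : ∀ M, Continuous (g M) := fun M => by
    simp only [hg, cutoff]; fun_prop
  have hgb : ∀ M y, ‖g M y‖ ≤ Real.exp (|c| * (M + 1)) := by
    intro M y
    rw [Real.norm_of_nonneg (hgnn M y)]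
    rcases le_total (|y|) (M + 1) with hy | hy
    · calc g M y ≤ Real.exp (c * y - c ^ 2 / 2) * 1 :=
            mul_le_mul_of_nonneg_left (cutoff_le_one _ _) (Real.exp_pos _).le
        _ ≤ Real.exp (|c| * (M + 1)) := by
          rw [mul_one, Real.exp_le_exp]
          have h1 : c * y ≤ |c| * |y| := by rw [← abs_mul]; exact le_abs_self _
          have h2 : |c| * |y| ≤ |c| * (M + 1) := by gcongr
          linarith [sq_nonneg c]
    · simp only [hg, cutoff_eq_zero hy, mul_zero]
      exact (Real.exp_pos _).le
  have hgi : ∀ M, Integrable (g M) ν := fun M =>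
    Integrable.of_bound (hgc M).aestronglyMeasurable _ (Eventually.of_forall (hgb M))
  have h1 : Tendsto (fun M => ∫ y, g M y ∂ν) atTop (𝓝 1) := by
    rw [tendsto_iff_norm_sub_tendsto_zero]
    refine squeeze_zero' (Eventually.of_forall fun M => norm_nonneg _) ?_
      (tendsto_const_div_atTop_nhds_zero_nat K)
    filter_upwards [eventually_gt_atTop 0] with M hM
    exact h M hM
  have h2 : Tendsto (fun M => ∫⁻ y, ENNReal.ofReal (g M y) ∂ν) atTop (𝓝 1) := by
    have := (ENNReal.continuous_ofReal.tendsto 1).comp h1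
    rw [ENNReal.ofReal_one] at this
    refine this.congr fun M => ?_
    exact ofReal_integral_eq_lintegral_ofReal (hgi M) (Eventually.of_forall (hgnn M))
  have h3 : Tendsto (fun M => ∫⁻ y, ENNReal.ofReal (g M y) ∂ν) atTop
      (𝓝 (∫⁻ y, ENNReal.ofReal (Real.exp (c * y - c ^ 2 / 2)) ∂ν)) := by
    refine lintegral_tendsto_of_tendsto_of_monotone
      (fun M => ((hgc M).measurable.ennreal_ofReal).aemeasurable) ?_ ?_
    · refine Eventually.of_forall fun y M M' hMM' => ?_
      refine ENNReal.ofReal_le_ofReal (mul_le_mul_of_nonneg_left ?_ (Real.exp_pos _).le)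
      exact cutoff_mono y (by exact_mod_cast hMM')
    · refine Eventually.of_forall fun y => tendsto_const_nhds.congr' ?_
      obtain ⟨m, hm⟩ := exists_nat_ge |y|
      filter_upwards [eventually_ge_atTop m] with M hM
      have : |y| ≤ M := hm.trans (by exact_mod_cast hM)
      simp [hg, cutoff_eq_one this]
  have h4 := tendsto_nhds_unique h3 h2
  have h5 : ∀ y : ℝ, ENNReal.ofReal (Real.exp (c * y))
      = ENNReal.ofReal (Real.exp (c ^ 2 / 2)) * ENNReal.ofReal (Real.exp (c * y - c ^ 2 / 2)) := by
    intro y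
    rw [← ENNReal.ofReal_mul (Real.exp_pos _).le, ← Real.exp_add]
    ring_nf
  simp_rw [h5]
  rw [lintegral_const_mul _ (by fun_prop), h4, mul_one]

/-- If the factorial moments of order `O(√λ)` are asymptotically those of a Poisson variable
with parameter `λ → ∞`, then the standardized variables are asymptotically normal. -/
theorem tendsto_uniformLaw_gaussianReal {ι α : Type*} {l : Filter ι} (S : ι → Finset α)
    (hS : ∀ i, (S i).Nonempty) (X : ι → α → ℕ) (lam : ι → ℝ) (hlam : Tendsto lam l atTop)
    (hF : ∀ C : ℝ, ∀ k : ι → ℕ, (∀ᶠ i in l, (k i : ℝ) ^ 2 ≤ C * lam i) →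
      Tendsto (fun i => (∑ a ∈ S i, ((X i a).descFactorial (k i) : ℝ)) / (S i).card
        / lam i ^ k i) l (𝓝 1))
    (hvar : ∀ᶠ i in l, (∑ a ∈ S i, (((X i a : ℝ) - lam i) / √(lam i)) ^ 2) / (S i).card ≤ 2) :
    Tendsto (fun i => uniformLaw (S i) (hS i) fun a => ((X i a : ℝ) - lam i) / √(lam i)) l
      (𝓝 (⟨ProbabilityTheory.gaussianReal 0 1, inferInstance⟩ : ProbabilityMeasure ℝ)) := by
  set μ : ι → ProbabilityMeasure ℝ :=
    fun i => uniformLaw (S i) (hS i) fun a => ((X i a : ℝ) - lam i) / √(lam i) with hμ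
  set G : Set ι := {i | (∑ a ∈ S i, (((X i a : ℝ) - lam i) / √(lam i)) ^ 2) / (S i).card ≤ 2}
    with hG
  have htight : IsTightMeasureSet {((ρ : ProbabilityMeasure ℝ) : Measure ℝ) | ρ ∈ μ '' G} := by
    rw [isTightMeasureSet_iff_exists_isCompact_measure_compl_le]
    intro ε hε
    obtain ⟨δ, hδ0, hδ⟩ : ∃ δ : ℝ, 0 < δ ∧ ENNReal.ofReal δ ≤ ε := by
      rcases eq_or_ne ε ⊤ with rfl | htop
      · exact ⟨1, one_pos, le_top⟩
      · exact ⟨ε.toReal, ENNReal.toReal_pos hε.ne' htop, ENNReal.ofReal_toReal_le⟩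
    refine ⟨Metric.closedBall 0 (√(2 / δ)), isCompact_closedBall _ _, ?_⟩
    rintro _ ⟨_, ⟨i, hi, rfl⟩, rfl⟩
    have h := uniformLaw_compl_closedBall_le (S i) (hS i)
      (fun a => ((X i a : ℝ) - lam i) / √(lam i)) (B := 2) (M := √(2 / δ)) (by positivity) hi
    rw [Real.sq_sqrt (by positivity), div_div_cancel₀ two_ne_zero] at h
    refine le_trans ?_ hδ
    rw [← ENNReal.ofReal_toReal (measure_ne_top (μ i : Measure ℝ) _)]
    exact ENNReal.ofReal_le_ofReal h
  refine (isCompact_closure_of_isTightMeasureSet htight).tendsto_nhds_of_unique_mapClusterPt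
    (hvar.mono fun i hi => subset_closure ⟨i, hi, rfl⟩) ?_
  intro ν _ hν
  obtain ⟨U, hU, hUν⟩ := mapClusterPt_iff_ultrafilter.mp hν
  rw [ProbabilityMeasure.tendsto_iff_forall_integral_tendsto] at hUν
  refine Subtype.ext (eq_gaussianReal_of_lintegral_exp (ν : Measure ℝ) fun c hc => ?_)
  refine lintegral_exp_of_tendsto_cutoff (ν : Measure ℝ)
    (K := 1 + (1 + Real.exp (2 * c ^ 2) * 2 + 2) / 2) fun M hM => ?_
  have hM' : (0 : ℝ) < M := by exact_mod_cast hM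
  set k : ι → ℕ := fun i => ⌊c * √(lam i)⌋₊ with hk
  have hk2 : ∀ᶠ i in l, (k i : ℝ) ^ 2 ≤ c ^ 2 * lam i := by
    filter_upwards [hlam.eventually_ge_atTop 0] with i hi
    have : (k i : ℝ) ≤ c * √(lam i) := Nat.floor_le (by positivity)
    calc (k i : ℝ) ^ 2 ≤ (c * √(lam i)) ^ 2 := by gcongr
      _ = c ^ 2 * lam i := by rw [mul_pow, Real.sq_sqrt hi]
  have hsqrt : Tendsto (fun i => √(lam i)) l atTop := Real.tendsto_sqrt_atTop.comp hlam
  have hkc : Tendsto (fun i => (k i : ℝ) / √(lam i)) l (𝓝 c) :=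
    (tendsto_nat_floor_mul_div_atTop hc.le).comp hsqrt
  have hk4 : ∀ᶠ i in l, 4 * (k i : ℝ) ≤ lam i := by
    filter_upwards [hsqrt.eventually_ge_atTop (4 * c), hlam.eventually_ge_atTop 0] with i hi h0
    have : (k i : ℝ) ≤ c * √(lam i) := Nat.floor_le (by positivity)
    calc 4 * (k i : ℝ) ≤ 4 * c * √(lam i) := by linarith
      _ ≤ √(lam i) * √(lam i) := by gcongr
      _ = lam i := Real.mul_self_sqrt h0
  have ha1 := hF (c ^ 2) k hk2
  have ha2 := hF (4 * c ^ 2) (fun i => 2 * k i) (by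
    filter_upwards [hk2] with i hi
    push_cast
    nlinarith)
  have hunif := tendstoUniformly_descFactorial_div_pow hlam hkc hc.le
    (M := (M : ℝ) + 1) (ε := 1 / M) (by positivity) (by positivity)
  have hgc : Continuous fun y : ℝ => Real.exp (c * y - c ^ 2 / 2) * cutoff M y := by
    simp only [cutoff]; fun_prop
  have hgb : ∀ y : ℝ, ‖Real.exp (c * y - c ^ 2 / 2) * cutoff M y‖
      ≤ Real.exp (c * (M + 1)) := by
    intro y
    rw [Real.norm_of_nonneg (mul_nonneg (Real.exp_pos _).le (cutoff_nonneg _ _))]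
    rcases le_total (|y|) (M + 1) with hy | hy
    · calc Real.exp (c * y - c ^ 2 / 2) * cutoff M y ≤ Real.exp (c * y - c ^ 2 / 2) * 1 :=
            mul_le_mul_of_nonneg_left (cutoff_le_one _ _) (Real.exp_pos _).le
        _ ≤ Real.exp (c * (M + 1)) := by
          rw [mul_one, Real.exp_le_exp]
          have h2 : c * y ≤ c * (M + 1) :=
            mul_le_mul_of_nonneg_left ((le_abs_self y).trans hy) hc.le
          linarith [sq_nonneg c]
    · simp only [cutoff_eq_zero hy, mul_zero]
      exact (Real.exp_pos _).le
  have hlim := hUν (BoundedContinuousFunction.ofNormedAddCommGroup _ hgc _ hgb)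
  simp only [BoundedContinuousFunction.coe_ofNormedAddCommGroup] at hlim
  have hdiff := (hlim.sub (ha1.mono_left hU)).abs
  refine le_of_tendsto hdiff (hU ?_)
  filter_upwards [hunif, hk4, hk2, ha2.eventually_le_const (show (1 : ℝ) < 2 by norm_num), hvar,
    hlam.eventually_gt_atTop 0] with i hi1 hi4 hi2 hia hiv hi0
  have hcard : (0 : ℝ) < (S i).card := by exact_mod_cast (hS i).card_pos
  rw [hμ, integral_uniformLaw]
  set Y : α → ℝ := fun a => ((X i a : ℝ) - lam i) / √(lam i) with hY
  set H : α → ℝ := fun a => ((X i a).descFactorial (k i) : ℝ) / lam i ^ k i with hH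
  have hpt : ∀ a ∈ S i, |Real.exp (c * Y a - c ^ 2 / 2) * cutoff M (Y a) - H a|
      ≤ 1 / M + (1 + Real.exp (2 * c ^ 2) *
        (((X i a).descFactorial (2 * k i) : ℝ) / lam i ^ (2 * k i)) + Y a ^ 2) / (2 * M) := by
    intro a _
    have hHnn : 0 ≤ H a := by positivity
    have hsq := sq_descFactorial_div_pow_le (x := X i a) hi0 hi4 hi2
    have h1 : |Real.exp (c * Y a - c ^ 2 / 2) - H a| * cutoff M (Y a) ≤ 1 / M := by
      rcases le_total (|Y a|) (M + 1) with hy | hy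
      · have h2 := hi1 (X i a) hy
        rw [abs_sub_comm] at h2
        calc _ ≤ 1 / (M : ℝ) * 1 := mul_le_mul h2 (cutoff_le_one _ _) (cutoff_nonneg _ _)
              (by positivity)
          _ = _ := mul_one _
      · rw [cutoff_eq_zero hy, mul_zero]; positivity
    have h3 : H a * (1 - cutoff M (Y a)) ≤ (H a ^ 2 + Y a ^ 2) / (2 * M) := by
      calc H a * (1 - cutoff M (Y a)) ≤ H a * (|Y a| / M) :=
            mul_le_mul_of_nonneg_left (one_sub_cutoff_le hM') hHnn
        _ = (2 * (H a * |Y a|)) / (2 * M) := by field_simp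
        _ ≤ (H a ^ 2 + Y a ^ 2) / (2 * M) := by
          gcongr
          rw [← sq_abs (Y a)]
          linarith [two_mul_le_add_sq (H a) |Y a|]
    have h4 : Real.exp (c * Y a - c ^ 2 / 2) * cutoff M (Y a) - H a
        = (Real.exp (c * Y a - c ^ 2 / 2) - H a) * cutoff M (Y a)
          - H a * (1 - cutoff M (Y a)) := by ring
    rw [h4]
    refine (abs_sub _ _).trans (add_le_add ?_ ?_)
    · rw [abs_mul, abs_of_nonneg (cutoff_nonneg _ _)]
      exact h1
    · rw [abs_of_nonneg (mul_nonneg hHnn (by linarith [cutoff_le_one M (Y a)]))]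
      refine h3.trans ?_
      gcongr
  have hHsum : (∑ a ∈ S i, ((X i a).descFactorial (k i) : ℝ)) / (S i).card / lam i ^ k i
      = (∑ a ∈ S i, H a) / (S i).card := by
    rw [div_right_comm, Finset.sum_div]
  rw [hHsum, ← sub_div, ← Finset.sum_sub_distrib, abs_div, abs_of_pos hcard, div_le_iff₀ hcard]
  refine (Finset.abs_sum_le_sum_abs _ _).trans ((Finset.sum_le_sum hpt).trans ?_)
  rw [Finset.sum_add_distrib, Finset.sum_const, nsmul_eq_mul, ← Finset.sum_div,
    Finset.sum_add_distrib, Finset.sum_add_distrib, ← Finset.mul_sum, ← Finset.sum_div]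
  simp only [Finset.sum_const, nsmul_eq_mul, mul_one]
  rw [div_right_comm, div_le_iff₀ hcard] at hia
  rw [div_le_iff₀ hcard] at hiv
  have hexp := mul_le_mul_of_nonneg_left hia (Real.exp_pos (2 * c ^ 2)).le
  have hfin : ((S i).card + Real.exp (2 * c ^ 2) *
      ((∑ a ∈ S i, ((X i a).descFactorial (2 * k i) : ℝ)) / lam i ^ (2 * k i))
      + ∑ a ∈ S i, Y a ^ 2) / (2 * M)
      ≤ ((1 + Real.exp (2 * c ^ 2) * 2 + 2) * (S i).card) / (2 * M) := by
    gcongr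
    linarith
  refine (add_le_add_right hfin _).trans (le_of_eq ?_)
  field_simp

namespace PlaneTree

/-- The degree statistic of a plane forest. -/
noncomputable def forestStat (F : List PlaneTree) : ℕ →₀ ℕ :=
  Multiset.toFinsupp (((fringeList F).map degree : List ℕ) : Multiset ℕ)

/-- The number of fringe subtrees of a plane forest that equal `T'`. -/
noncomputable def forestCount (T' : PlaneTree) (F : List PlaneTree) : ℕ :=
  ((fringeList F).filter fun t => decide (t = T')).length

lemma fringeList_append (F G : List PlaneTree) :
    fringeList (F ++ G) = fringeList F ++ fringeList G := by
  induction F with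
  | nil => simp [fringeList]
  | cons T F ih => simp [fringeList, ih]

@[simp] lemma forestStat_nil : forestStat [] = 0 := by
  simp [forestStat, fringeList]

lemma forestStat_append (F G : List PlaneTree) :
    forestStat (F ++ G) = forestStat F + forestStat G := by
  simp only [forestStat, fringeList_append, List.map_append, ← Multiset.coe_add, map_add]

lemma degStat_node (ts : List PlaneTree) :
    degStat (node ts) = Finsupp.single ts.length 1 + forestStat ts := by
  simp only [degStat, fringe, List.map_cons, degree, forestStat]
  rw [← Multiset.cons_coe, ← Multiset.singleton_add, map_add, Multiset.toFinsupp_singleton]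

lemma forestStat_cons (T : PlaneTree) (F : List PlaneTree) :
    forestStat (T :: F) = degStat T + forestStat F := by
  simp only [forestStat, fringeList, degStat, List.map_append, ← Multiset.coe_add, map_add]

@[simp] lemma forestStat_singleton (T : PlaneTree) : forestStat [T] = degStat T := by
  simp [forestStat_cons]

@[simp] lemma forestCount_nil (T' : PlaneTree) : forestCount T' [] = 0 := by
  simp [forestCount, fringeList]

lemma forestCount_append (T' : PlaneTree) (F G : List PlaneTree) :
    forestCount T' (F ++ G) = forestCount T' F + forestCount T' G := by
  simp [forestCount, fringeList_append]

lemma forestCount_cons (T' T : PlaneTree) (F : List PlaneTree) :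
    forestCount T' (T :: F) = countTree T' T + forestCount T' F := by
  simp [forestCount, fringeList, countTree]

@[simp] lemma forestCount_singleton (T' T : PlaneTree) :
    forestCount T' [T] = countTree T' T := by
  simp [forestCount_cons]

lemma countTree_node (T' : PlaneTree) (ts : List PlaneTree) :
    countTree T' (node ts) = (if node ts = T' then 1 else 0) + forestCount T' ts := by
  simp only [countTree, fringe, forestCount, List.filter_cons, decide_eq_true_eq]
  split_ifs <;> simp [add_comm]

mutual
  lemma sizeOf_le_of_mem_fringe {S : PlaneTree} :
      ∀ T : PlaneTree, S ∈ fringe T → sizeOf S ≤ sizeOf T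
    | node ts, h => by
      rw [fringe, List.mem_cons] at h
      rcases h with rfl | h
      · exact le_rfl
      · have := sizeOf_lt_of_mem_fringeList ts h
        rw [node.sizeOf_spec]
        omega
  lemma sizeOf_lt_of_mem_fringeList {S : PlaneTree} :
      ∀ ts : List PlaneTree, S ∈ fringeList ts → sizeOf S < sizeOf ts
    | [], h => by simp [fringeList] at h
    | T :: ts, h => by
      rw [fringeList, List.mem_append] at h
      rw [List.cons.sizeOf_spec]
      rcases h with h | h
      · have := sizeOf_le_of_mem_fringe T h
        omega
      · have := sizeOf_lt_of_mem_fringeList ts h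
        omega
end

lemma forestCount_children (ts : List PlaneTree) : forestCount (node ts) ts = 0 := by
  rw [forestCount, List.length_eq_zero_iff, List.filter_eq_nil_iff]
  intro S hS
  have := sizeOf_lt_of_mem_fringeList ts hS
  simp only [decide_eq_true_eq]
  rintro rfl
  rw [node.sizeOf_spec] at this
  omega

lemma countTree_self (T : PlaneTree) : countTree T T = 1 := by
  cases T with
  | node ts => rw [countTree_node, if_pos rfl, forestCount_children]

mutual
  lemma countTree_smul_degStat_le (T' : PlaneTree) :
      ∀ T : PlaneTree, countTree T' T • degStat T' ≤ degStat T
    | node ts => by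
      by_cases h : node ts = T'
      · rw [← h, countTree_self, one_smul]
      · rw [countTree_node, if_neg h, zero_add, degStat_node]
        exact (forestCount_smul_degStat_le T' ts).trans le_add_self
  lemma forestCount_smul_degStat_le (T' : PlaneTree) :
      ∀ F : List PlaneTree, forestCount T' F • degStat T' ≤ forestStat F
    | [] => by simp
    | T :: F => by
      rw [forestCount_cons, forestStat_cons, add_smul]
      exact add_le_add (countTree_smul_degStat_le T' T) (forestCount_smul_degStat_le T' F)
end

end PlaneTree

lemma nsize_add (a b : ℕ →₀ ℕ) : nsize (a + b) = nsize a + nsize b :=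
  Finsupp.sum_add_index' (fun _ => rfl) fun _ _ _ => rfl

lemma nsize_single (i c : ℕ) : nsize (Finsupp.single i c) = c :=
  Finsupp.sum_single_index rfl

lemma nsize_smul (k : ℕ) (a : ℕ →₀ ℕ) : nsize (k • a) = k * nsize a := by
  induction k with
  | zero => simp [nsize]
  | succ k ih => rw [add_smul, one_smul, nsize_add, ih]; ring

lemma nsize_eq_zero {a : ℕ →₀ ℕ} (h : nsize a = 0) : a = 0 := by
  ext i
  by_contra hi
  have h1 : i ∈ a.support := Finsupp.mem_support_iff.2 hi
  exact hi (Finset.sum_eq_zero_iff.1 h i h1)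

/-- The weight `∑ i · n(i)` of a degree statistic. -/
noncomputable def nweight (n : ℕ →₀ ℕ) : ℕ := n.sum fun i c => i * c

lemma nweight_add (a b : ℕ →₀ ℕ) : nweight (a + b) = nweight a + nweight b :=
  Finsupp.sum_add_index' (fun _ => rfl) fun _ _ _ => mul_add _ _ _

lemma nweight_single (i c : ℕ) : nweight (Finsupp.single i c) = i * c :=
  Finsupp.sum_single_index rfl

lemma nweight_smul (k : ℕ) (a : ℕ →₀ ℕ) : nweight (k • a) = k * nweight a := by
  induction k with
  | zero => simp [nweight]
  | succ k ih => rw [add_smul, one_smul, nweight_add, ih]; ring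

namespace PlaneTree

lemma nsize_forestStat (F : List PlaneTree) : nsize (forestStat F) = (fringeList F).length := by
  rw [nsize, forestStat]
  rw [show (fringeList F).length
    = Multiset.card (((fringeList F).map degree : List ℕ) : Multiset ℕ) by simp]
  rw [← Multiset.toFinsupp_sum_eq]
  rfl

mutual
  lemma nsize_degStat : ∀ T : PlaneTree, nsize (degStat T) = 1 + nweight (degStat T)
    | node ts => by
      rw [degStat_node, nsize_add, nweight_add, nsize_single, nweight_single,
        nsize_forestStat_eq ts, mul_one]
  lemma nsize_forestStat_eq :
      ∀ F : List PlaneTree, nsize (forestStat F) = F.length + nweight (forestStat F)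
    | [] => by simp [nsize, nweight]
    | T :: F => by
      rw [forestStat_cons, nsize_add, nweight_add, nsize_degStat T, nsize_forestStat_eq F,
        List.length_cons]
      ring
end

lemma size_eq_nsize (T : PlaneTree) : size T = nsize (degStat T) := by
  rw [← forestStat_singleton, nsize_forestStat, size]
  simp [fringeList]

/-- Grafting: join the first `i` trees of a forest below a new root. -/
def graft (i : ℕ) (F : List PlaneTree) : List PlaneTree := node (F.take i) :: F.drop i

lemma forestStat_graft {i : ℕ} {F : List PlaneTree} (h : i ≤ F.length) :
    forestStat (graft i F) = Finsupp.single i 1 + forestStat F := by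
  rw [graft, forestStat_cons, degStat_node, List.length_take, min_eq_left h, add_assoc,
    ← forestStat_append, List.take_append_drop]

lemma forestCount_graft (T' : PlaneTree) (i : ℕ) (F : List PlaneTree) :
    forestCount T' (graft i F)
      = (if node (F.take i) = T' then 1 else 0) + forestCount T' F := by
  rw [graft, forestCount_cons, countTree_node, add_assoc, ← forestCount_append,
    List.take_append_drop]

lemma exists_graft {j : ℕ} {n : ℕ →₀ ℕ} {F : List PlaneTree} (hl : F.length = j + 1)
    (hs : forestStat F = n) : ∃ i ∈ n.support, ∃ G : List PlaneTree,
      G.length = j + i ∧ forestStat G = n - Finsupp.single i 1 ∧ graft i G = F := by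
  match F, hl with
  | node ts :: F, hl =>
    have hst : n = Finsupp.single ts.length 1 + forestStat (ts ++ F) := by
      rw [← hs, forestStat_cons, degStat_node, forestStat_append, add_assoc]
    refine ⟨ts.length, ?_, ts ++ F, ?_, ?_, ?_⟩
    · rw [hst]; simp
    · rw [List.length_append]
      rw [List.length_cons] at hl
      omega
    · rw [hst, add_tsub_cancel_left]
    · simp [graft]

lemma finite_forests (N : ℕ) : ∀ (j : ℕ) (n : ℕ →₀ ℕ), nsize n = N →
    {F : List PlaneTree | F.length = j ∧ forestStat F = n}.Finite := by
  induction N with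
  | zero =>
    intro j n hn
    refine (Set.finite_singleton []).subset ?_
    rintro F ⟨-, hs⟩
    have h := nsize_forestStat_eq F
    rw [hs, hn] at h
    exact List.length_eq_zero_iff.1 (by omega)
  | succ N ih =>
    intro j n hn
    match j with
    | 0 =>
      refine (Set.finite_singleton []).subset ?_
      rintro F ⟨hl, -⟩
      exact List.length_eq_zero_iff.1 hl
    | j + 1 =>
      have hfin : (⋃ i ∈ n.support, graft i ''
          {F : List PlaneTree | F.length = j + i ∧ forestStat F = n - Finsupp.single i 1}).Finite := by
        refine Set.Finite.biUnion n.support.finite_toSet fun i hi => (ih _ _ ?_).image _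
        have h1 : n - Finsupp.single i 1 + Finsupp.single i 1 = n :=
          tsub_add_cancel_of_le (Finsupp.single_le_iff.2
            (Nat.one_le_iff_ne_zero.2 (Finsupp.mem_support_iff.1 hi)))
        have h2 := congrArg nsize h1
        rw [nsize_add, nsize_single] at h2
        omega
      refine hfin.subset ?_
      rintro F ⟨hl, hs⟩
      obtain ⟨i, hi, G, hGl, hGs, rfl⟩ := exists_graft hl hs
      exact Set.mem_biUnion hi ⟨G, ⟨hGl, hGs⟩, rfl⟩

/-- The plane forests with `j` trees and degree statistic `n`. -/
noncomputable def forests (j : ℕ) (n : ℕ →₀ ℕ) : Finset (List PlaneTree) :=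
  (finite_forests _ j n rfl).toFinset

@[simp] lemma mem_forests {j : ℕ} {n : ℕ →₀ ℕ} {F : List PlaneTree} :
    F ∈ forests j n ↔ F.length = j ∧ forestStat F = n := by
  simp [forests]

lemma sum_forests_succ {M : Type*} [AddCommMonoid M] (j : ℕ) (n : ℕ →₀ ℕ)
    (f : List PlaneTree → M) :
    ∑ F ∈ forests (j + 1) n, f F
      = ∑ i ∈ n.support, ∑ F ∈ forests (j + i) (n - Finsupp.single i 1), f (graft i F) := by
  rw [Finset.sum_sigma']
  symm
  refine Finset.sum_bij (fun x _ => graft x.1 x.2) ?_ ?_ ?_ fun _ _ => rfl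
  · rintro ⟨i, F⟩ h
    simp only [Finset.mem_sigma, mem_forests] at h
    obtain ⟨hi, hl, hs⟩ := h
    dsimp only
    rw [mem_forests, forestStat_graft (by omega), hs, graft, List.length_cons, List.length_drop]
    refine ⟨by omega, add_tsub_cancel_of_le (Finsupp.single_le_iff.2
            (Nat.one_le_iff_ne_zero.2 (Finsupp.mem_support_iff.1 hi)))⟩
  · rintro ⟨i, F⟩ h ⟨i', F'⟩ h' heq
    simp only [Finset.mem_sigma, mem_forests] at h h'
    simp only [graft, List.cons.injEq, node.injEq] at heq
    obtain ⟨h1, h2⟩ := heq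
    have hF : F = F' := by
      rw [← List.take_append_drop i F, h1, h2, List.take_append_drop]
    have hi : i = i' := by
      have := congrArg List.length h1
      rw [List.length_take, List.length_take] at this
      omega
    subst hF hi
    rfl
  · intro F h
    rw [mem_forests] at h
    obtain ⟨i, hi, G, hGl, hGs, rfl⟩ := exists_graft h.1 h.2
    exact ⟨⟨i, G⟩, by simp only [Finset.mem_sigma, mem_forests]; exact ⟨hi, hGl, hGs⟩, rfl⟩

/-- The sum over all plane forests with `j` trees and degree statistic `n` of the number of
`k`-subsets of the fringe subtrees equal to `T'`. -/
noncomputable def forestMoment (T' : PlaneTree) (j : ℕ) (n : ℕ →₀ ℕ) (k : ℕ) : ℕ :=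
  ∑ F ∈ forests j n, (forestCount T' F).choose k

lemma forestMoment_eq_zero {T' : PlaneTree} {j : ℕ} {n : ℕ →₀ ℕ} {k : ℕ}
    (h : ¬ k • degStat T' ≤ n) : forestMoment T' j n k = 0 := by
  refine Finset.sum_eq_zero fun F hF => Nat.choose_eq_zero_of_lt ?_
  by_contra! hk
  refine h ?_
  rw [← (mem_forests.1 hF).2]
  exact le_trans (by gcongr) (forestCount_smul_degStat_le T' F)

lemma forestMoment_succ_zero (T' : PlaneTree) (j : ℕ) (n : ℕ →₀ ℕ) :
    forestMoment T' (j + 1) n 0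
      = ∑ i ∈ n.support, forestMoment T' (j + i) (n - Finsupp.single i 1) 0 := by
  simp only [forestMoment, Nat.choose_zero_right]
  exact sum_forests_succ j n fun _ => 1

lemma forestMoment_succ_succ (T' : PlaneTree) (j : ℕ) (n : ℕ →₀ ℕ) (k : ℕ) :
    forestMoment T' (j + 1) (n + degStat T') (k + 1)
      = ∑ i ∈ (n + degStat T').support,
          forestMoment T' (j + i) (n + degStat T' - Finsupp.single i 1) (k + 1)
        + forestMoment T' j n k := by
  have hbij : forestMoment T' j n k = ∑ F ∈ forests (j + 1) (n + degStat T'),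
      if F.head? = some T' then (forestCount T' F - 1).choose k else 0 := by
    rw [← Finset.sum_filter]
    refine Finset.sum_bij (fun F _ => T' :: F) ?_ ?_ ?_ ?_
    · intro F hF
      rw [mem_forests] at hF
      simp [forestStat_cons, hF, add_comm]
    · intro F _ G _ h
      simpa using h
    · intro F hF
      match F, hF with
      | [], hF => simp at hF
      | S :: F, hF =>
        simp only [Finset.mem_filter, mem_forests, List.length_cons, forestStat_cons,
          List.head?_cons, Option.some.injEq] at hF
        obtain ⟨⟨h1, h2⟩, rfl⟩ := hF
        refine ⟨F, mem_forests.2 ⟨by omega, ?_⟩, rfl⟩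
        rw [add_comm] at h2
        exact add_right_cancel h2
    · intro F _
      rw [forestCount_cons, countTree_self, Nat.add_sub_cancel_left]
  rw [hbij, forestMoment, sum_forests_succ, sum_forests_succ, ← Finset.sum_add_distrib]
  refine Finset.sum_congr rfl fun i _ => ?_
  rw [forestMoment, ← Finset.sum_add_distrib]
  refine Finset.sum_congr rfl fun F _ => ?_
  rw [forestCount_graft]
  by_cases h : node (F.take i) = T'
  · rw [if_pos h, if_pos (by simp [graft, h]), Nat.add_sub_cancel_left, add_comm 1,
      Nat.choose_succ_succ, add_comm]
  · rw [if_neg h, if_neg (by simpa [graft] using h), zero_add, add_zero]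

end PlaneTree

lemma nsize_sub_single {r : ℕ →₀ ℕ} {i : ℕ} (hi : i ∈ r.support) :
    nsize (r - Finsupp.single i 1) + 1 = nsize r := by
  have h1 : r - Finsupp.single i 1 + Finsupp.single i 1 = r :=
    tsub_add_cancel_of_le (Finsupp.single_le_iff.2
      (Nat.one_le_iff_ne_zero.2 (Finsupp.mem_support_iff.1 hi)))
  conv_rhs => rw [← h1, nsize_add, nsize_single]

lemma nweight_sub_single {r : ℕ →₀ ℕ} {i : ℕ} (hi : i ∈ r.support) :
    nweight (r - Finsupp.single i 1) + i = nweight r := by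
  have h1 : r - Finsupp.single i 1 + Finsupp.single i 1 = r :=
    tsub_add_cancel_of_le (Finsupp.single_le_iff.2
      (Nat.one_le_iff_ne_zero.2 (Finsupp.mem_support_iff.1 hi)))
  conv_rhs => rw [← h1, nweight_add, nweight_single, mul_one]

/-- The product `∏ n(i)!`. -/
noncomputable def nfact (n : ℕ →₀ ℕ) : ℕ := n.prod fun _ c => c.factorial

lemma nfact_eq_prod {n : ℕ →₀ ℕ} {s : Finset ℕ} (h : n.support ⊆ s) :
    nfact n = ∏ i ∈ s, (n i).factorial :=
  Finsupp.prod_of_support_subset n h _ fun _ _ => Nat.factorial_zero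

lemma nfact_sub_single {r : ℕ →₀ ℕ} {i : ℕ} (hi : i ∈ r.support) :
    r i * nfact (r - Finsupp.single i 1) = nfact r := by
  have hsub : (r - Finsupp.single i 1).support ⊆ r.support := Finsupp.support_tsub
  rw [nfact_eq_prod hsub, nfact_eq_prod subset_rfl, ← Finset.mul_prod_erase _ _ hi,
    ← Finset.mul_prod_erase _ (fun j => (r j).factorial) hi, ← mul_assoc]
  congr 1
  · rw [Finsupp.tsub_apply, Finsupp.single_eq_same]
    exact Nat.mul_factorial_pred (Finsupp.mem_support_iff.1 hi)
  · refine Finset.prod_congr rfl fun j hj => ?_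
    rw [Finsupp.tsub_apply, Finsupp.single_eq_of_ne (Finset.ne_of_mem_erase hj), tsub_zero]

namespace PlaneTree

lemma sum_forestMoment_support (T' : PlaneTree) (j : ℕ) (r : ℕ →₀ ℕ) (k : ℕ) :
    ∑ i ∈ (r + k • degStat T').support,
        forestMoment T' (j + i) (r + k • degStat T' - Finsupp.single i 1) k
      = ∑ i ∈ r.support,
        forestMoment T' (j + i) (r - Finsupp.single i 1 + k • degStat T') k := by
  have hsub : r.support ⊆ (r + k • degStat T').support := by
    intro i hi
    simp only [Finsupp.mem_support_iff, Finsupp.add_apply] at hi ⊢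
    omega
  rw [← Finset.sum_subset hsub]
  · refine Finset.sum_congr rfl fun i hi => ?_
    rw [tsub_add_eq_add_tsub (Finsupp.single_le_iff.2
      (Nat.one_le_iff_ne_zero.2 (Finsupp.mem_support_iff.1 hi)))]
  · intro i hi hir
    refine forestMoment_eq_zero fun h => ?_
    have h1 := h i
    simp only [Finsupp.mem_support_iff, Finsupp.add_apply, not_not] at hi hir
    simp only [Finsupp.tsub_apply, Finsupp.add_apply, Finsupp.single_eq_same, hir] at h1
    rw [hir] at hi
    omega

lemma forestMoment_mul (T' : PlaneTree) (s : ℕ) : ∀ (j : ℕ) (r : ℕ →₀ ℕ) (k : ℕ),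
    nsize r + k = s → s = j + nweight r →
    forestMoment T' j (r + k • degStat T') k * nfact r * k.factorial
      = if s = 0 then 1 else j * (s - 1).factorial := by
  induction s with
  | zero =>
    intro j r k h1 h2
    obtain rfl : r = 0 := nsize_eq_zero (by omega)
    obtain rfl : k = 0 := by omega
    obtain rfl : j = 0 := by omega
    have : forests 0 0 = {[]} := by
      ext F
      simp only [mem_forests, List.length_eq_zero_iff, Finset.mem_singleton]
      exact ⟨fun h => h.1, fun h => ⟨h, by simp [h]⟩⟩
    simp [forestMoment, nfact, this]
  | succ s ih =>
    intro j r k h1 h2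
    rw [if_neg (by omega), Nat.add_sub_cancel]
    match j with
    | 0 =>
      have : forests 0 (r + k • degStat T') = ∅ := by
        refine Finset.eq_empty_of_forall_notMem fun F hF => ?_
        obtain ⟨hl, hs⟩ := mem_forests.1 hF
        rw [List.length_eq_zero_iff.1 hl, forestStat_nil] at hs
        have h3 := congrArg nsize hs
        rw [nsize_add, nsize_smul, nsize_degStat] at h3
        simp only [nsize, Finsupp.sum_zero_index] at h3
        have h4 : nsize r = 0 := by
          change 0 = nsize r + _ at h3
          omega
        have h5 : k = 0 := by
          have : k * (1 + nweight (degStat T')) = 0 := by omega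
          rcases Nat.mul_eq_zero.1 this with h | h <;> omega
        omega
      simp [forestMoment, this]
    | j + 1 =>
      have hA : (∑ i ∈ r.support,
          forestMoment T' (j + i) (r - Finsupp.single i 1 + k • degStat T') k)
            * nfact r * k.factorial
          = ∑ i ∈ r.support, r i * (if s = 0 then 1 else (j + i) * (s - 1).factorial) := by
        rw [Finset.sum_mul, Finset.sum_mul]
        refine Finset.sum_congr rfl fun i hi => ?_
        have h3 := nsize_sub_single hi
        have h4 := nweight_sub_single hi
        rw [← ih (j + i) (r - Finsupp.single i 1) k (by omega) (by omega),
          ← nfact_sub_single hi]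
        ring
      have hB : forestMoment T' (j + 1) (r + k • degStat T') k * nfact r * k.factorial
          = ∑ i ∈ r.support, r i * (if s = 0 then 1 else (j + i) * (s - 1).factorial)
            + k * (if s = 0 then 1 else j * (s - 1).factorial) := by
        rw [← hA, ← sum_forestMoment_support]
        match k with
        | 0 => rw [forestMoment_succ_zero, zero_mul, add_zero]
        | k + 1 =>
          rw [← ih j r k (by omega) (by omega)]
          rw [show r + (k + 1) • degStat T' = r + k • degStat T' + degStat T' by
            rw [add_smul, one_smul, add_assoc], forestMoment_succ_succ, Nat.factorial_succ]
          ring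
      have hr : ∑ i ∈ r.support, r i = nsize r := rfl
      have hw : ∑ i ∈ r.support, i * r i = nweight r := rfl
      rw [hB]
      match s with
      | 0 =>
        simp only [if_true, mul_one, hr]
        have : j = 0 := by omega
        rw [this, h1]
        rfl
      | s + 1 =>
        simp only [Nat.add_eq_zero_iff, one_ne_zero, and_false, if_false, Nat.add_sub_cancel]
        have h3 : ∑ i ∈ r.support, r i * ((j + i) * s.factorial)
            = (j * nsize r + nweight r) * s.factorial := by
          rw [← hr, ← hw, Finset.mul_sum, ← Finset.sum_add_distrib, Finset.sum_mul]
          exact Finset.sum_congr rfl fun i _ => by ring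
        rw [h3, Nat.factorial_succ]
        have h4 : j * nsize r + nweight r + k * j = (j + 1) * (s + 1) := by
          have : j * nsize r + k * j = j * (s + 2) := by
            rw [← h1]; ring
          have h5 : j * (s + 2) = j * (s + 1) + j := by ring
          have h6 : (j + 1) * (s + 1) = j * (s + 1) + (s + 1) := by ring
          omega
        rw [← mul_assoc (j + 1), ← h4]
        ring

/-- The plane trees with degree statistic `n`, as a finite set. -/
noncomputable def trees (n : ℕ →₀ ℕ) : Finset PlaneTree :=
  (forests 1 n).preimage (fun T => [T]) (Function.Injective.injOn fun _ _ h => by simpa using h)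

@[simp] lemma mem_trees {n : ℕ →₀ ℕ} {T : PlaneTree} : T ∈ trees n ↔ degStat T = n := by
  simp [trees]

lemma coe_trees (n : ℕ →₀ ℕ) : (trees n : Set PlaneTree) = treesWith n := by
  ext T; simp [treesWith]

lemma sum_trees_choose (T' : PlaneTree) (n : ℕ →₀ ℕ) (k : ℕ) :
    ∑ T ∈ trees n, (countTree T' T).choose k = forestMoment T' 1 n k := by
  refine Finset.sum_bij (fun T _ => [T]) ?_ ?_ ?_ ?_
  · intro T hT
    rw [mem_trees] at hT
    simp [hT]
  · intro T _ S _ h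
    simpa using h
  · intro F hF
    obtain ⟨hl, hs⟩ := mem_forests.1 hF
    obtain ⟨T, rfl⟩ := List.length_eq_one_iff.1 hl
    exact ⟨T, by simpa using hs, rfl⟩
  · intro T _
    rw [forestCount_singleton]

lemma card_trees_mul {n : ℕ →₀ ℕ} (hn : IsDegStat n) :
    (trees n).card * nfact n = (nsize n - 1).factorial := by
  have hn' : nsize n = 1 + nweight n := hn
  have h1 := forestMoment_mul (node []) _ 1 n 0 rfl hn'
  rw [zero_smul, add_zero, ← sum_trees_choose] at h1
  simp only [Nat.choose_zero_right, Finset.sum_const, smul_eq_mul, mul_one, Nat.factorial_zero,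
    add_zero, one_mul] at h1
  rw [h1, if_neg (by omega)]

lemma trees_nonempty {n : ℕ →₀ ℕ} (hn : IsDegStat n) : (trees n).Nonempty := by
  rw [← Finset.card_pos]
  refine Nat.pos_of_ne_zero fun h => ?_
  have h1 := card_trees_mul hn
  rw [h, zero_mul] at h1
  exact (Nat.factorial_pos _).ne h1

/-- The factorial moments of the number of fringe trees equal to `T'` in a uniformly random
tree with degree statistic `n`. -/
lemma factorial_moment {n : ℕ →₀ ℕ} (hn : IsDegStat n) (T' : PlaneTree) (k : ℕ) :
    (∑ T ∈ trees n, ((countTree T' T).descFactorial k : ℝ)) / (trees n).card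
      = (∏ i ∈ (degStat T').support, ((n i).descFactorial (k * degStat T' i) : ℝ))
        / ((nsize n - 1).descFactorial (k * (size T' - 1)) : ℝ) := by
  have hcard : ((trees n).card : ℝ) ≠ 0 := by
    exact_mod_cast (Finset.card_pos.2 (trees_nonempty hn)).ne'
  have hsum : ∑ T ∈ trees n, ((countTree T' T).descFactorial k : ℝ)
      = ((k.factorial * forestMoment T' 1 n k : ℕ) : ℝ) := by
    rw [← sum_trees_choose, Finset.mul_sum]
    push_cast [Nat.descFactorial_eq_factorial_mul_choose]
    rfl
  rw [hsum]
  by_cases hle : k • degStat T' ≤ n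
  · obtain ⟨r, rfl⟩ : ∃ r, n = r + k • degStat T' := ⟨n - k • degStat T', by
      rw [tsub_add_cancel_of_le hle]⟩
    have hn' : nsize (r + k • degStat T') = 1 + nweight (r + k • degStat T') := hn
    have hT := nsize_degStat T'
    have hnr := hn'
    rw [nsize_add, nweight_add, nsize_smul, nweight_smul, hT] at hnr
    have hr : nsize r + k = 1 + nweight r := by
      have : k * (1 + nweight (degStat T')) = k + k * nweight (degStat T') := by ring
      omega
    have h1 := forestMoment_mul T' _ 1 r k rfl hr
    rw [if_neg (by omega), one_mul] at h1
    have hsz : nsize (r + k • degStat T') - 1 = (nsize r + k - 1) + k * (size T' - 1) := by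
      rw [nsize_add, nsize_smul, size_eq_nsize, hT]
      have : k * (1 + nweight (degStat T')) = k + k * nweight (degStat T') := by ring
      rw [Nat.add_sub_cancel_left]
      omega
    have h2 := card_trees_mul hn
    have hdesc : (nsize r + k - 1).factorial
        * (nsize (r + k • degStat T') - 1).descFactorial (k * (size T' - 1))
        = (nsize (r + k • degStat T') - 1).factorial := by
      rw [← Nat.factorial_mul_descFactorial (n := nsize (r + k • degStat T') - 1)
        (k := k * (size T' - 1)) (by omega), hsz, Nat.add_sub_cancel]
    have hprod : nfact r * ∏ i ∈ (degStat T').support,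
        ((r + k • degStat T') i).descFactorial (k * degStat T' i) = nfact (r + k • degStat T') := by
      have hs : (∏ i ∈ (degStat T').support,
          ((r + k • degStat T') i).descFactorial (k * degStat T' i))
          = ∏ i ∈ r.support ∪ (degStat T').support,
          ((r + k • degStat T') i).descFactorial (k * degStat T' i) := by
        refine Finset.prod_subset Finset.subset_union_right fun i _ hi => ?_
        rw [Finsupp.notMem_support_iff.1 hi, mul_zero, Nat.descFactorial_zero]
      rw [hs, nfact_eq_prod Finset.subset_union_left,
        nfact_eq_prod (n := r + k • degStat T') (s := r.support ∪ (degStat T').support),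
        ← Finset.prod_mul_distrib]
      · refine Finset.prod_congr rfl fun i _ => ?_
        rw [← Nat.factorial_mul_descFactorial (n := (r + k • degStat T') i)
          (k := k * degStat T' i) (by simp)]
        simp
      · intro i hi
        simp only [Finset.mem_union, Finsupp.mem_support_iff, Finsupp.add_apply,
          Finsupp.smul_apply, smul_eq_mul] at hi ⊢
        by_contra! h
        rw [h.1, h.2, mul_zero] at hi
        exact hi rfl
    have hd0 : ((nsize (r + k • degStat T') - 1).descFactorial (k * (size T' - 1)) : ℝ) ≠ 0 := by
      intro h
      rw [Nat.cast_eq_zero] at h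
      rw [h, mul_zero] at hdesc
      exact (Nat.factorial_pos _).ne hdesc
    have hf0 : nfact r ≠ 0 :=
      Finset.prod_ne_zero_iff.2 fun i _ => (Nat.factorial_pos _).ne'
    rw [div_eq_div_iff hcard hd0]
    have key : nfact r * (k.factorial * forestMoment T' 1 (r + k • degStat T') k
        * (nsize (r + k • degStat T') - 1).descFactorial (k * (size T' - 1)))
        = nfact r * ((∏ i ∈ (degStat T').support,
        ((r + k • degStat T') i).descFactorial (k * degStat T' i))
          * (trees (r + k • degStat T')).card) := by
      rw [← mul_assoc (nfact r) (∏ i ∈ _, _), hprod, mul_comm (nfact (_ + _)), h2, ← hdesc, ← h1]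
      ring
    exact_mod_cast mul_left_cancel₀ hf0 key
  · rw [forestMoment_eq_zero hle]
    have : ∃ i, n i < k * degStat T' i := by
      by_contra! h
      exact hle fun i => by simpa using h i
    obtain ⟨i, hi⟩ := this
    rw [Finset.prod_eq_zero (i := i), mul_zero, Nat.cast_zero, zero_div, zero_div]
    · rw [Finsupp.mem_support_iff]
      intro h
      rw [h, mul_zero] at hi
      omega
    · rw [Nat.descFactorial_of_lt hi, Nat.cast_zero]

end PlaneTree

lemma descFactorial_div_pow_le_one (x j : ℕ) : (x.descFactorial j : ℝ) / (x : ℝ) ^ j ≤ 1 :=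
  div_le_one_of_le₀ (by exact_mod_cast Nat.descFactorial_le_pow x j) (by positivity)

lemma one_sub_le_descFactorial_div_pow {x : ℕ} (hx : 0 < x) (j : ℕ) :
    1 - (j : ℝ) ^ 2 / x ≤ (x.descFactorial j : ℝ) / (x : ℝ) ^ j := by
  have hx' : (0 : ℝ) < x := by exact_mod_cast hx
  induction j with
  | zero => simp
  | succ j ih =>
    rcases le_or_gt j x with h | h
    · have h1 : 0 ≤ 1 - (j : ℝ) / x := by
        rw [sub_nonneg, div_le_one hx']; exact_mod_cast h
      have h2 : ((x.descFactorial (j + 1) : ℕ) : ℝ) / (x : ℝ) ^ (j + 1)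
          = (1 - (j : ℝ) / x) * ((x.descFactorial j : ℝ) / (x : ℝ) ^ j) := by
        rw [Nat.descFactorial_succ, Nat.cast_mul, Nat.cast_sub h]
        field_simp
        ring
      rw [h2]
      refine le_trans ?_ (mul_le_mul_of_nonneg_left ih h1)
      have h3 : 0 ≤ (j : ℝ) / x * ((j : ℝ) ^ 2 / x) := by positivity
      have h4 : ((j + 1 : ℕ) : ℝ) ^ 2 / x = (j : ℝ) ^ 2 / x + 2 * (j / x) + 1 / x := by
        push_cast; ring
      have h5 : 0 ≤ 1 / (x : ℝ) := by positivity
      have h6 : 0 ≤ (j : ℝ) / x := by positivity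
      rw [h4]
      linarith
    · refine le_trans ?_ (by positivity)
      rw [sub_nonpos, one_le_div hx']
      have : (x : ℝ) < j := by exact_mod_cast h
      have h1 : (1 : ℝ) ≤ x := by exact_mod_cast hx
      push_cast
      nlinarith

lemma one_sub_sum_one_sub_le_prod {ι : Type*} (s : Finset ι) (a : ι → ℝ)
    (h0 : ∀ i ∈ s, 0 ≤ a i) (h1 : ∀ i ∈ s, a i ≤ 1) :
    1 - ∑ i ∈ s, (1 - a i) ≤ ∏ i ∈ s, a i := by
  induction s using Finset.induction_on with
  | empty => simp
  | insert i s his ih =>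
    rw [Finset.sum_insert his, Finset.prod_insert his]
    have h2 := ih (fun j hj => h0 j (Finset.mem_insert_of_mem hj))
      fun j hj => h1 j (Finset.mem_insert_of_mem hj)
    have h3 : ∏ j ∈ s, a j ≤ 1 := Finset.prod_le_one
      (fun j hj => h0 j (Finset.mem_insert_of_mem hj))
      fun j hj => h1 j (Finset.mem_insert_of_mem hj)
    have h4 := h1 i (Finset.mem_insert_self i s)
    nlinarith [mul_nonneg (sub_nonneg.2 h4) (sub_nonneg.2 h3)]

namespace PlaneTree

lemma mul_piDist_div_le {n : ℕ →₀ ℕ} {T' : PlaneTree} {c : ℝ}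
    (hc : ∀ i, empDist n i ≤ c) {i : ℕ} (hi : i ∈ (degStat T').support) (hni : 0 < n i)
    (hN : 0 < nsize n) :
    (nsize n : ℝ) * piDist (empDist n) T' / n i ≤ c ^ (size T' - 1) := by
  have hp : ∀ j, 0 ≤ empDist n j := fun j => div_nonneg (by positivity) (by positivity)
  have ht : 0 < degStat T' i := Nat.pos_of_ne_zero (Finsupp.mem_support_iff.1 hi)
  have hsz : size T' - 1 = (degStat T' i - 1) + ∑ j ∈ (degStat T').support.erase i, degStat T' j := by
    have : size T' = ∑ j ∈ (degStat T').support, degStat T' j := size_eq_nsize T'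
    rw [this, ← Finset.add_sum_erase _ _ hi]
    omega
  have hni' : (0 : ℝ) < n i := by exact_mod_cast hni
  have hN' : (0 : ℝ) < nsize n := by exact_mod_cast hN
  have hfac : (nsize n : ℝ) * piDist (empDist n) T' / n i
      = empDist n i ^ (degStat T' i - 1)
        * ∏ j ∈ (degStat T').support.erase i, empDist n j ^ degStat T' j := by
    rw [piDist, Finsupp.prod, ← Finset.mul_prod_erase _ _ hi]
    obtain ⟨d, hd⟩ : ∃ d, degStat T' i = d + 1 := ⟨degStat T' i - 1, by omega⟩
    rw [hd, Nat.add_sub_cancel, pow_succ]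
    conv_lhs => enter [1, 2, 1, 2]; rw [empDist]
    field_simp
  rw [hfac, hsz, pow_add, ← Finset.prod_pow_eq_pow_sum]
  have hc0 : 0 ≤ c := (hp 0).trans (hc 0)
  refine mul_le_mul (pow_le_pow_left₀ (hp i) (hc i) _) ?_
    (Finset.prod_nonneg fun j _ => pow_nonneg (hp j) _) (pow_nonneg hc0 _)
  exact Finset.prod_le_prod (fun j _ => pow_nonneg (hp j) _)
    fun j _ => pow_le_pow_left₀ (hp j) (hc j) _

lemma abs_factorial_moment_div_sub_one_le {n : ℕ →₀ ℕ} (hn : IsDegStat n) (T' : PlaneTree) {c : ℝ}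
    (hc : ∀ i, empDist n i ≤ c) {lam : ℝ}
    (hlam : lam = (nsize n : ℝ) * piDist (empDist n) T') (hpos : 0 < lam) (k : ℕ) {ε : ℝ}
    (hε : ε = (k : ℝ) ^ 2 / lam * ((size T' : ℝ) ^ 2 * c ^ (size T' - 1))) (hε' : ε ≤ 1 / 2) :
    |(∑ T ∈ trees n, ((countTree T' T).descFactorial k : ℝ)) / (trees n).card / lam ^ k - 1|
      ≤ 2 * ε := by
  have hn' : nsize n = 1 + nweight n := hn
  have hN : 0 < nsize n := by omega
  have hNr : (0 : ℝ) < nsize n := by exact_mod_cast hN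
  set t := degStat T' with ht
  have hm : size T' = ∑ i ∈ t.support, t i := size_eq_nsize T'
  have hm1 : size T' = 1 + nweight t := by rw [size_eq_nsize, nsize_degStat]
  have hni : ∀ i ∈ t.support, 0 < n i := by
    intro i hi
    refine Nat.pos_of_ne_zero fun h => hpos.ne' ?_
    rw [hlam, piDist, Finsupp.prod, Finset.prod_eq_zero hi, mul_zero]
    rw [empDist, h, Nat.cast_zero, zero_div, zero_pow (Finsupp.mem_support_iff.1 hi)]
  have hinv : ∀ i ∈ t.support, 1 / (n i : ℝ) ≤ c ^ (size T' - 1) / lam := by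
    intro i hi
    have h := mul_piDist_div_le hc hi (hni i hi) hN
    rw [← hlam] at h
    have h1 : (0 : ℝ) < n i := by exact_mod_cast hni i hi
    rw [le_div_iff₀ hpos, one_div_mul_eq_div]
    exact h
  have hc0 : 0 ≤ c := le_trans (div_nonneg (by positivity) (by positivity)) (hc 0)
  set A : ℝ := ∏ i ∈ t.support, ((n i).descFactorial (k * t i) : ℝ) / (n i : ℝ) ^ (k * t i) with hA
  set B : ℝ := ((nsize n - 1).descFactorial (k * (size T' - 1)) : ℝ)
    / (nsize n : ℝ) ^ (k * (size T' - 1)) with hB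
  have hA0 : ∀ i ∈ t.support, 0 ≤ ((n i).descFactorial (k * t i) : ℝ) / (n i : ℝ) ^ (k * t i) :=
    fun i _ => by positivity
  have hA1 : A ≤ 1 := Finset.prod_le_one hA0 fun i _ => descFactorial_div_pow_le_one _ _
  have hA2 : 1 - ε ≤ A := by
    refine le_trans ?_ (one_sub_sum_one_sub_le_prod _ _ hA0
      fun i _ => descFactorial_div_pow_le_one _ _)
    rw [sub_le_sub_iff_left]
    have h1 : ∀ i ∈ t.support, 1 - ((n i).descFactorial (k * t i) : ℝ) / (n i : ℝ) ^ (k * t i)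
        ≤ (t i : ℝ) ^ 2 * ((k : ℝ) ^ 2 * (c ^ (size T' - 1) / lam)) := by
      intro i hi
      have h2 := one_sub_le_descFactorial_div_pow (hni i hi) (k * t i)
      have h3 : ((k * t i : ℕ) : ℝ) ^ 2 / n i = (t i : ℝ) ^ 2 * ((k : ℝ) ^ 2 * (1 / n i)) := by
        push_cast; ring
      have h4 : (t i : ℝ) ^ 2 * ((k : ℝ) ^ 2 * (1 / n i))
          ≤ (t i : ℝ) ^ 2 * ((k : ℝ) ^ 2 * (c ^ (size T' - 1) / lam)) :=
        mul_le_mul_of_nonneg_left (mul_le_mul_of_nonneg_left (hinv i hi) (by positivity))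
          (by positivity)
      linarith
    refine (Finset.sum_le_sum h1).trans ?_
    rw [← Finset.sum_mul]
    have h5 : ∑ i ∈ t.support, (t i : ℝ) ^ 2 ≤ (size T' : ℝ) ^ 2 := by
      rw [hm]
      push_cast
      exact Finset.sum_sq_le_sq_sum_of_nonneg fun i _ => by positivity
    calc _ ≤ (size T' : ℝ) ^ 2 * ((k : ℝ) ^ 2 * (c ^ (size T' - 1) / lam)) := by gcongr
      _ = ε := by rw [hε]; ring
  have hB1 : B ≤ 1 := by
    refine div_le_one_of_le₀ ?_ (by positivity)
    have h1 := Nat.descFactorial_le_pow (nsize n - 1) (k * (size T' - 1))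
    have h2 : (nsize n - 1) ^ (k * (size T' - 1)) ≤ nsize n ^ (k * (size T' - 1)) :=
      Nat.pow_le_pow_left (Nat.sub_le _ _) _
    exact_mod_cast h1.trans h2
  have hB2 : 1 - ε ≤ B := by
    rcases Nat.eq_zero_or_pos k with rfl | hk
    · simp [hB, hε]
    · have h1 : B = ((nsize n).descFactorial (k * (size T' - 1) + 1) : ℝ)
          / (nsize n : ℝ) ^ (k * (size T' - 1) + 1) := by
        obtain ⟨M, hM⟩ : ∃ M, nsize n = M + 1 := ⟨nsize n - 1, by omega⟩
        rw [hB, hM, Nat.add_sub_cancel, Nat.succ_descFactorial_succ, pow_succ', Nat.cast_mul,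
          mul_div_mul_left]
        positivity
      rw [h1]
      refine le_trans ?_ (one_sub_le_descFactorial_div_pow hN _)
      rw [sub_le_sub_iff_left]
      have h2 : k * (size T' - 1) + 1 ≤ k * size T' := by
        rw [hm1, Nat.add_sub_cancel_left, mul_add]
        omega
      have h3 : ((k * (size T' - 1) + 1 : ℕ) : ℝ) ≤ k * size T' := by exact_mod_cast h2
      obtain ⟨i, hi⟩ : t.support.Nonempty := by
        rw [Finset.nonempty_iff_ne_empty]
        intro h
        rw [h, Finset.sum_empty] at hm
        omega
      have h4 : 1 / (nsize n : ℝ) ≤ c ^ (size T' - 1) / lam := by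
        refine le_trans ?_ (hinv i hi)
        have h5 : n i ≤ nsize n := Finset.single_le_sum (f := fun j => n j)
          (fun _ _ => Nat.zero_le _) (Finsupp.mem_support_iff.2 (hni i hi).ne')
        have h6 : (0 : ℝ) < n i := by exact_mod_cast hni i hi
        exact one_div_le_one_div_of_le h6 (by exact_mod_cast h5)
      calc ((k * (size T' - 1) + 1 : ℕ) : ℝ) ^ 2 / nsize n
          ≤ (k * size T' : ℝ) ^ 2 / nsize n := by gcongr
        _ = (k * size T' : ℝ) ^ 2 * (1 / nsize n) := by ring
        _ ≤ (k * size T' : ℝ) ^ 2 * (c ^ (size T' - 1) / lam) := by gcongr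
        _ = ε := by rw [hε]; ring
  have hBpos : 0 < B := by linarith
  have hAB : (∑ T ∈ trees n, ((countTree T' T).descFactorial k : ℝ)) / (trees n).card / lam ^ k
      = A / B := by
    rw [factorial_moment hn, hA, hB, Finset.prod_div_distrib, hlam, piDist, Finsupp.prod]
    have h1 : ((nsize n : ℝ) * ∏ i ∈ t.support, empDist n i ^ t i) ^ k
        = (∏ i ∈ t.support, (n i : ℝ) ^ (k * t i)) / (nsize n : ℝ) ^ (k * (size T' - 1)) := by
      rw [mul_pow, ← Finset.prod_pow]
      have h2 : ∏ i ∈ t.support, (empDist n i ^ t i) ^ k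
          = (∏ i ∈ t.support, (n i : ℝ) ^ (k * t i)) / (nsize n : ℝ) ^ (k * size T') := by
        rw [hm, Finset.mul_sum, ← Finset.prod_pow_eq_pow_sum, ← Finset.prod_div_distrib]
        refine Finset.prod_congr rfl fun i _ => ?_
        rw [empDist, ← pow_mul, mul_comm k, div_pow]
      have h3 : k * size T' = k + k * (size T' - 1) := by
        rw [hm1, Nat.add_sub_cancel_left]; ring
      rw [h2, h3, pow_add]
      field_simp
    rw [h1]
    simp only [div_div_eq_mul_div]
    ring
  rw [hAB, div_sub_one hBpos.ne', abs_div, abs_of_pos hBpos, div_le_iff₀ hBpos]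
  have hε0 : 0 ≤ ε := by rw [hε]; positivity
  have hABε : |A - B| ≤ ε := abs_le.2 ⟨by linarith, by linarith⟩
  nlinarith

end PlaneTree

lemma exists_empDist_le {nseq : ℕ → (ℕ →₀ ℕ)} {p : ℕ → ℝ} (hcond : Condition1 nseq p)
    (hp0 : p 0 < 1) (hp1 : p 1 < 1) :
    ∃ c : ℝ, 0 < c ∧ c < 1 ∧ ∀ᶠ κ in atTop, ∀ i, empDist (nseq κ) i ≤ c := by
  obtain ⟨hdeg, -, -, -, hlim⟩ := hcond
  refine ⟨max (1 / 2) (max ((1 + p 0) / 2) ((1 + p 1) / 2)), lt_max_of_lt_left (by norm_num),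
    max_lt (by norm_num) (max_lt (by linarith) (by linarith)), ?_⟩
  have h0 : ∀ᶠ κ in atTop, empDist (nseq κ) 0 < (1 + p 0) / 2 :=
    (hlim 0).eventually_lt_const (by linarith)
  have h1 : ∀ᶠ κ in atTop, empDist (nseq κ) 1 < (1 + p 1) / 2 :=
    (hlim 1).eventually_lt_const (by linarith)
  filter_upwards [h0, h1] with κ h0 h1 i
  match i with
  | 0 => exact h0.le.trans ((le_max_left _ _).trans (le_max_right _ _))
  | 1 => exact h1.le.trans ((le_max_right _ _).trans (le_max_right _ _))
  | i + 2 =>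
    refine le_trans ?_ (le_max_left _ _)
    have hn : nsize (nseq κ) = 1 + nweight (nseq κ) := hdeg κ
    have hw : 2 * nseq κ (i + 2) ≤ nweight (nseq κ) := by
      by_cases h : nseq κ (i + 2) = 0
      · rw [h]; exact Nat.zero_le _
      · have h2 : (i + 2) * nseq κ (i + 2) ≤ nweight (nseq κ) :=
          Finset.single_le_sum (f := fun j => j * nseq κ j)
            (fun _ _ => Nat.zero_le _) (Finsupp.mem_support_iff.2 h)
        exact le_trans (Nat.mul_le_mul_right _ (by omega)) h2
    have hN : (0 : ℝ) < nsize (nseq κ) := by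
      rw [hn]; positivity
    rw [empDist, div_le_div_iff₀ hN (by norm_num)]
    have : nseq κ (i + 2) * 2 ≤ 1 * nsize (nseq κ) := by omega
    exact_mod_cast this

lemma tendsto_sq_mul_pow_sub_one {c : ℝ} (hc0 : 0 < c) (hc1 : c < 1) {m : ℕ → ℕ}
    (hm : Tendsto m atTop atTop) :
    Tendsto (fun κ => (m κ : ℝ) ^ 2 * c ^ (m κ - 1)) atTop (𝓝 0) := by
  have h := ((tendsto_pow_const_mul_const_pow_of_abs_lt_one 2
    (by rwa [abs_of_pos hc0] : |c| < 1)).comp hm).div_const c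
  rw [zero_div] at h
  refine h.congr' ?_
  filter_upwards [hm.eventually_ge_atTop 1] with κ hκ
  simp only [Function.comp]
  obtain ⟨d, hd⟩ : ∃ d, m κ = d + 1 := ⟨m κ - 1, by omega⟩
  rw [hd, Nat.add_sub_cancel, pow_succ c]
  field_simp

lemma prob_eq (n : ℕ →₀ ℕ) (P : PlaneTree → Prop) :
    prob n P = (((PlaneTree.trees n).filter P).card : ℝ) / (PlaneTree.trees n).card := by
  rw [prob, numTrees, ← PlaneTree.coe_trees, Set.ncard_coe_finset,
    ← Set.ncard_coe_finset ((PlaneTree.trees n).filter P), Finset.coe_filter]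
  rfl

lemma expect_eq (n : ℕ →₀ ℕ) (f : PlaneTree → ℕ) :
    expect n f = (∑ T ∈ PlaneTree.trees n, (f T : ℝ)) / (PlaneTree.trees n).card := by
  have h : HasSum (fun k : ℕ => ∑ T ∈ PlaneTree.trees n,
      if k = f T then (f T : ℝ) / (PlaneTree.trees n).card else 0)
      (∑ T ∈ PlaneTree.trees n, (f T : ℝ) / (PlaneTree.trees n).card) :=
    hasSum_sum fun T _ => hasSum_ite_eq (f T) _
  rw [Finset.sum_div, ← h.tsum_eq, expect]
  refine tsum_congr fun k => ?_
  rw [prob_eq, Finset.card_filter]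
  push_cast
  rw [Finset.sum_div, Finset.mul_sum]
  refine Finset.sum_congr rfl fun T _ => ?_
  by_cases hk : f T = k
  · rw [if_pos hk, if_pos hk.symm, hk, mul_one_div]
  · rw [if_neg hk, if_neg (Ne.symm hk), zero_div, mul_zero]

lemma stdNormalCDF_eq (x : ℝ) :
    stdNormalCDF x = (ProbabilityTheory.gaussianReal 0 1).real (Set.Iic x) := by
  rw [Measure.real, ProbabilityTheory.gaussianReal_apply_eq_integral 0 one_ne_zero,
    ENNReal.toReal_ofReal
      (integral_nonneg fun y => ProbabilityTheory.gaussianPDFReal_nonneg 0 1 y), stdNormalCDF]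
  refine integral_congr_ae (ae_of_all _ fun t => ?_)
  simp [ProbabilityTheory.gaussianPDFReal, div_eq_inv_mul]

/-- The factorial moment of order `k` of `N_{T'}(𝒯_n)`. -/
noncomputable def factorialMoment (n : ℕ →₀ ℕ) (T' : PlaneTree) (k : ℕ) : ℝ :=
  (∑ T ∈ PlaneTree.trees n, ((PlaneTree.countTree T' T).descFactorial k : ℝ))
    / (PlaneTree.trees n).card

lemma expect_countTree (n : ℕ →₀ ℕ) (T' : PlaneTree) :
    expect n (PlaneTree.countTree T') = factorialMoment n T' 1 := by
  simp [expect_eq, factorialMoment]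

lemma expect_countTree_sq (n : ℕ →₀ ℕ) (T' : PlaneTree) :
    expect n (fun T => PlaneTree.countTree T' T ^ 2)
      = factorialMoment n T' 2 + factorialMoment n T' 1 := by
  rw [expect_eq, factorialMoment, factorialMoment, ← add_div, ← Finset.sum_add_distrib]
  congr 1
  refine Finset.sum_congr rfl fun T _ => ?_
  have h : ∀ x : ℕ, x ^ 2 = x.descFactorial 2 + x.descFactorial 1 := by
    intro x
    cases x with
    | zero => rfl
    | succ x =>
      simp only [Nat.descFactorial_succ, Nat.descFactorial_zero, Nat.add_sub_cancel, Nat.sub_zero]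
      ring
  exact_mod_cast h _

lemma sum_sq_sub_div {n : ℕ →₀ ℕ} (hn : IsDegStat n) (T' : PlaneTree) {lam : ℝ} (hlam : 0 < lam) :
    (∑ T ∈ PlaneTree.trees n, (((PlaneTree.countTree T' T : ℝ) - lam) / √lam) ^ 2)
        / (PlaneTree.trees n).card
      = (factorialMoment n T' 2 + factorialMoment n T' 1 - 2 * lam * factorialMoment n T' 1
          + lam ^ 2) / lam := by
  have hcard : ((PlaneTree.trees n).card : ℝ) ≠ 0 := by
    exact_mod_cast (Finset.card_pos.2 (PlaneTree.trees_nonempty hn)).ne'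
  rw [← expect_countTree_sq, ← expect_countTree, expect_eq, expect_eq]
  have h : ∀ T, (((PlaneTree.countTree T' T : ℝ) - lam) / √lam) ^ 2
      = ((PlaneTree.countTree T' T : ℝ) ^ 2 - 2 * lam * PlaneTree.countTree T' T + lam ^ 2)
        / lam := by
    intro T
    rw [div_pow, Real.sq_sqrt hlam.le]
    ring
  simp only [h]
  rw [← Finset.sum_div, Finset.sum_add_distrib, Finset.sum_sub_distrib, ← Finset.mul_sum,
    Finset.sum_const, nsmul_eq_mul]
  push_cast
  field_simp

section Asymptotics

variable {nseq : ℕ → (ℕ →₀ ℕ)} {p : ℕ → ℝ} {Tseq : ℕ → PlaneTree} {lam : ℕ → ℝ}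

lemma exists_abs_factorialMoment_div_pow_sub_one_le
    (hcond : Condition1 nseq p) (hp0 : p 0 < 1) (hp1 : p 1 < 1)
    (hsize : Tendsto (fun κ => PlaneTree.size (Tseq κ)) atTop atTop)
    (hlam : lam = fun κ => (nsize (nseq κ) : ℝ) * piDist (empDist (nseq κ)) (Tseq κ))
    (hconv : Tendsto lam atTop atTop) :
    ∃ δ : ℕ → ℝ, Tendsto δ atTop (𝓝 0) ∧ (∀ κ, 0 ≤ δ κ) ∧ ∀ C : ℝ, ∀ k : ℕ → ℕ,
      (∀ᶠ κ in atTop, (k κ : ℝ) ^ 2 ≤ C * lam κ) → ∀ᶠ κ in atTop,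
        |factorialMoment (nseq κ) (Tseq κ) (k κ) / lam κ ^ k κ - 1|
          ≤ 2 * ((k κ : ℝ) ^ 2 / lam κ * δ κ) := by
  obtain ⟨c, hc0, hc1, hc⟩ := exists_empDist_le hcond hp0 hp1
  have hδ := tendsto_sq_mul_pow_sub_one hc0 hc1 hsize
  refine ⟨_, hδ, fun κ => by positivity, fun C k hk => ?_⟩
  have hCδ := hδ.const_mul C
  rw [mul_zero] at hCδ
  filter_upwards [hk, hc, hconv.eventually_gt_atTop 0,
    hCδ.eventually_le_const (show (0 : ℝ) < 1 / 2 by norm_num)] with κ hkκ hcκ hpos hle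
  refine PlaneTree.abs_factorial_moment_div_sub_one_le (hcond.1 κ) (Tseq κ) hcκ (by rw [hlam]) hpos
    (k κ) rfl (le_trans ?_ hle)
  have : (k κ : ℝ) ^ 2 / lam κ ≤ C := by rwa [div_le_iff₀ hpos]
  gcongr

lemma tendsto_factorialMoment_div_pow
    (hcond : Condition1 nseq p) (hp0 : p 0 < 1) (hp1 : p 1 < 1)
    (hsize : Tendsto (fun κ => PlaneTree.size (Tseq κ)) atTop atTop)
    (hlam : lam = fun κ => (nsize (nseq κ) : ℝ) * piDist (empDist (nseq κ)) (Tseq κ))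
    (hconv : Tendsto lam atTop atTop) (C : ℝ) (k : ℕ → ℕ)
    (hk : ∀ᶠ κ in atTop, (k κ : ℝ) ^ 2 ≤ C * lam κ) :
    Tendsto (fun κ => factorialMoment (nseq κ) (Tseq κ) (k κ) / lam κ ^ k κ) atTop (𝓝 1) := by
  obtain ⟨δ, hδ, hδ0, h⟩ := exists_abs_factorialMoment_div_pow_sub_one_le hcond hp0 hp1 hsize hlam hconv
  rw [tendsto_iff_norm_sub_tendsto_zero]
  have hCδ := (hδ.const_mul C).const_mul 2
  rw [mul_zero, mul_zero] at hCδ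
  refine squeeze_zero' (Eventually.of_forall fun _ => norm_nonneg _) ?_ hCδ
  filter_upwards [h C k hk, hk, hconv.eventually_gt_atTop 0] with κ h1 hkκ hpos
  rw [Real.norm_eq_abs]
  refine h1.trans ?_
  have : (k κ : ℝ) ^ 2 / lam κ ≤ C := by rwa [div_le_iff₀ hpos]
  have := hδ0 κ
  gcongr

lemma tendsto_mul_factorialMoment_div_pow_sub_one
    (hcond : Condition1 nseq p) (hp0 : p 0 < 1) (hp1 : p 1 < 1)
    (hsize : Tendsto (fun κ => PlaneTree.size (Tseq κ)) atTop atTop)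
    (hlam : lam = fun κ => (nsize (nseq κ) : ℝ) * piDist (empDist (nseq κ)) (Tseq κ))
    (hconv : Tendsto lam atTop atTop) (k : ℕ) :
    Tendsto (fun κ => lam κ * (factorialMoment (nseq κ) (Tseq κ) k / lam κ ^ k - 1))
      atTop (𝓝 0) := by
  obtain ⟨δ, hδ, hδ0, h⟩ := exists_abs_factorialMoment_div_pow_sub_one_le hcond hp0 hp1 hsize hlam hconv
  rw [tendsto_zero_iff_norm_tendsto_zero]
  have hCδ := hδ.const_mul (2 * (k : ℝ) ^ 2)
  rw [mul_zero] at hCδ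
  refine squeeze_zero' (Eventually.of_forall fun _ => norm_nonneg _) ?_ hCδ
  have hk : ∀ᶠ κ in atTop, (k : ℝ) ^ 2 ≤ 1 * lam κ := by
    simpa using hconv.eventually_ge_atTop ((k : ℝ) ^ 2)
  filter_upwards [h 1 (fun _ => k) hk, hconv.eventually_gt_atTop 0] with κ h1 hpos
  rw [Real.norm_eq_abs, abs_mul, abs_of_pos hpos]
  refine (mul_le_mul_of_nonneg_left h1 hpos.le).trans (le_of_eq ?_)
  field_simp

end Asymptotics

/-- Theorem 3.2(ii): normal limit for the number of fringe trees equal to a growing tree,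
with convergence of mean and variance. -/
theorem fringe_growing_normal
    (nseq : ℕ → (ℕ →₀ ℕ)) (p : ℕ → ℝ) (Tseq : ℕ → PlaneTree)
    (hcond : Condition1 nseq p) (hp0 : p 0 < 1) (hp1 : p 1 < 1)
    (hsize : Tendsto (fun κ => PlaneTree.size (Tseq κ)) atTop atTop)
    (hconv : Tendsto (fun κ => (nsize (nseq κ) : ℝ) * piDist (empDist (nseq κ)) (Tseq κ))
      atTop atTop) :
    (∀ x : ℝ, Tendsto
      (fun κ => prob (nseq κ) (fun T =>
        ((PlaneTree.countTree (Tseq κ) T : ℝ)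
            - (nsize (nseq κ) : ℝ) * piDist (empDist (nseq κ)) (Tseq κ))
          / Real.sqrt ((nsize (nseq κ) : ℝ) * piDist (empDist (nseq κ)) (Tseq κ)) ≤ x))
      atTop (𝓝 (stdNormalCDF x))) ∧
    Tendsto (fun κ =>
        (expect (nseq κ) (PlaneTree.countTree (Tseq κ))
            - (nsize (nseq κ) : ℝ) * piDist (empDist (nseq κ)) (Tseq κ))
          / Real.sqrt ((nsize (nseq κ) : ℝ) * piDist (empDist (nseq κ)) (Tseq κ)))
      atTop (𝓝 0) ∧
    Tendsto (fun κ =>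
        expect (nseq κ) (PlaneTree.countTree (Tseq κ))
          / ((nsize (nseq κ) : ℝ) * piDist (empDist (nseq κ)) (Tseq κ)))
      atTop (𝓝 1) ∧
    Tendsto (fun κ =>
        variance (nseq κ) (PlaneTree.countTree (Tseq κ))
          / ((nsize (nseq κ) : ℝ) * piDist (empDist (nseq κ)) (Tseq κ)))
      atTop (𝓝 1) := by

  set lam : ℕ → ℝ := fun κ => (nsize (nseq κ) : ℝ) * piDist (empDist (nseq κ)) (Tseq κ) with hlam
  have hpos := hconv.eventually_gt_atTop (0 : ℝ)
  have hF := tendsto_factorialMoment_div_pow hcond hp0 hp1 hsize hlam hconv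
  have hD := tendsto_mul_factorialMoment_div_pow_sub_one hcond hp0 hp1 hsize hlam hconv
  have hD1 := hD 1
  have hD2 := hD 2
  have ha1 : Tendsto (fun κ => factorialMoment (nseq κ) (Tseq κ) 1 / lam κ) atTop (𝓝 1) := by
    simpa using hF 1 (fun _ => 1) (by simpa using hconv.eventually_ge_atTop 1)
  have hvar : ∀ᶠ κ in atTop, (∑ T ∈ PlaneTree.trees (nseq κ),
      (((PlaneTree.countTree (Tseq κ) T : ℝ) - lam κ) / √(lam κ)) ^ 2)
        / (PlaneTree.trees (nseq κ)).card ≤ 2 := by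
    have h := (hD2.add ha1).sub (hD1.const_mul 2)
    rw [show (0 : ℝ) + 1 - 2 * 0 = 1 by norm_num] at h
    filter_upwards [hpos, h.eventually_le_const (show (1 : ℝ) < 2 by norm_num)] with κ hκ h2
    rw [sum_sq_sub_div (hcond.1 κ) _ hκ]
    refine le_trans (le_of_eq ?_) h2
    field_simp
    ring
  have hweak := tendsto_uniformLaw_gaussianReal (fun κ => PlaneTree.trees (nseq κ))
    (fun κ => PlaneTree.trees_nonempty (hcond.1 κ)) (fun κ T => PlaneTree.countTree (Tseq κ) T)
    lam hconv hF hvar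
  refine ⟨fun x => ?_, ?_, ?_, ?_⟩
  · have hnull : (show ProbabilityMeasure ℝ from
        ⟨ProbabilityTheory.gaussianReal 0 1, inferInstance⟩) (frontier (Set.Iic x)) = 0 := by
      rw [frontier_Iic, ProbabilityMeasure.null_iff_toMeasure_null]
      have := ProbabilityTheory.nullSingletonClass_gaussianReal (μ := 0) (v := 1) one_ne_zero
      exact measure_singleton (μ := ProbabilityTheory.gaussianReal 0 1) x
    have h := ProbabilityMeasure.tendsto_measure_of_null_frontier_of_tendsto hweak hnull
    rw [stdNormalCDF_eq]
    have h' := (NNReal.continuous_coe.tendsto _).comp h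
    refine Tendsto.congr (fun κ => ?_) h'
    rw [prob_eq]
    exact uniformLaw_real_apply _ _ _ measurableSet_Iic
  · have h := hD1.div_atTop (Real.tendsto_sqrt_atTop.comp hconv)
    refine h.congr' ?_
    filter_upwards [hpos] with κ hκ
    rw [expect_countTree, pow_one, Function.comp_apply]
    change _ = (_ - lam κ) / _
    congr 1
    field_simp
  · simpa only [expect_countTree] using ha1
  · have h := (hD2.add ha1).sub (hD1.mul (ha1.add_const 1))
    rw [show (0 : ℝ) + 1 - 0 * (1 + 1) = 1 by norm_num] at h
    refine h.congr' ?_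
    filter_upwards [hpos] with κ hκ
    rw [variance, expect_countTree_sq, expect_countTree]
    change _ = _ / lam κ
    field_simp
    ring
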